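/- arXiv:1307.3695 — 3 statements merged into one kernel-verified Lean document; each statement's English description precedes it below -/
import Mathlib

section
/- Let k > 0, let T : C[0,1] → L¹(0,1) be a linear bounded operator, and suppose the spectral radius of Λ₊T : C[0,1] → C[0,1] is less than 1, where (Λ₊f)(t) = ∫_0^t (s/t)^k f(s) ds. Then for every f ∈ L¹(0,1) the Cauchy problem x' = -(k/t)x + Tx + f, x(0) = 0 has a unique solution x ∈ AC[0,1] with x(0)=0 and ∫_0^1 |x|/t dt < ∞. -/
open MeasureTheory Set Filter Topology

/-- The operator `Λ₊`. -/
noncomputable def lamPlus (k : ℝ) (h : ℝ → ℝ) (t : ℝ) : ℝ :=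
  ∫ s in Ioc (0:ℝ) t, (s / t) ^ k * h s

/-- The kernel used for Fubini. -/
noncomputable def kerK (k : ℝ) (s r : ℝ) : ℝ :=
  if r ≤ s then k * s ^ (-k - 1) * r ^ k else 0

lemma kerK_eq_indicator (k r t : ℝ) (hr : 0 < r) :
    EqOn ((Icc r t).indicator fun s => k * s ^ (-k - 1) * r ^ k)
      (fun s => kerK k s r) (Ioc 0 t) := by
  intro s hs
  by_cases h : r ≤ s
  · simp [kerK, h, hs.2]
  · simp [kerK, h]

lemma kerK_integrable (k r t : ℝ) (hr : 0 < r) (hrt : r ≤ t) :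
    IntegrableOn (fun s => kerK k s r) (Ioc 0 t) ∧
      ∫ s in Ioc 0 t, kerK k s r = 1 - (r / t) ^ k := by
  have hc : ContinuousOn (fun s : ℝ => k * s ^ (-k - 1) * r ^ k) (Icc r t) := by
    intro s hs
    have : s ≠ 0 := (hr.trans_le hs.1).ne'
    exact (((Real.continuousAt_rpow_const s _ (Or.inl this)).const_mul k).mul_const _).continuousWithinAt
  have hi : Integrable ((Icc r t).indicator fun s : ℝ => k * s ^ (-k - 1) * r ^ k) :=
    (integrable_indicator_iff measurableSet_Icc).2 (hc.integrableOn_Icc)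
  constructor
  · exact hi.integrableOn.congr_fun (kerK_eq_indicator k r t hr) measurableSet_Ioc
  · rw [← setIntegral_congr_fun measurableSet_Ioc (kerK_eq_indicator k r t hr),
      setIntegral_indicator measurableSet_Icc]
    have : Ioc 0 t ∩ Icc r t = Icc r t := by
      apply inter_eq_right.2
      intro s hs
      exact ⟨hr.trans_le hs.1, hs.2⟩
    rw [this, integral_Icc_eq_integral_Ioc, ← intervalIntegral.integral_of_le hrt]
    have hd : ∀ s ∈ uIcc r t, HasDerivAt (fun s : ℝ => -(s ^ (-k) * r ^ k))
        (k * s ^ (-k - 1) * r ^ k) s := by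
      intro s hs
      rw [uIcc_of_le hrt] at hs
      have : s ≠ 0 := (hr.trans_le hs.1).ne'
      have := ((Real.hasDerivAt_rpow_const (p := -k) (Or.inl this)).mul_const (r ^ k)).neg
      exact this.congr_deriv (by ring)
    rw [intervalIntegral.integral_eq_sub_of_hasDerivAt hd]
    · have ht : 0 < t := hr.trans_le hrt
      rw [Real.div_rpow hr.le ht.le, Real.rpow_neg hr.le, Real.rpow_neg ht.le]
      have := (Real.rpow_pos_of_pos hr k).ne'
      have := (Real.rpow_pos_of_pos ht k).ne'
      field_simp
      ring
    · apply ContinuousOn.intervalIntegrable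
      rwa [uIcc_of_le hrt]

lemma kerK_nonneg (k s r : ℝ) (hk : 0 < k) (hr : 0 < r) : 0 ≤ kerK k s r := by
  unfold kerK
  split_ifs with h
  · have := hr.trans_le h
    positivity
  · exact le_rfl

lemma weight_integrable (k t : ℝ) (hk : 0 < k) (h : ℝ → ℝ)
    (hh : IntegrableOn h (Ioc 0 t)) : IntegrableOn (fun s => (s / t) ^ k * h s) (Ioc 0 t) := by
  refine Integrable.bdd_mul (c := 1) hh ?_ ?_
  · exact (by fun_prop : Measurable fun s : ℝ => (s / t) ^ k).aestronglyMeasurable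
  · filter_upwards [ae_restrict_mem measurableSet_Ioc] with s hs
    have h0 : 0 ≤ s / t := div_nonneg hs.1.le (hs.1.le.trans hs.2)
    have h1 : s / t ≤ 1 := div_le_one_of_le₀ hs.2 (hs.1.le.trans hs.2)
    rw [Real.norm_of_nonneg (by positivity)]
    exact Real.rpow_le_one h0 h1 hk.le

lemma kerK_measurable (k : ℝ) : Measurable (fun p : ℝ × ℝ => kerK k p.1 p.2) := by
  unfold kerK
  apply Measurable.ite
  · exact measurableSet_le measurable_snd measurable_fst
  · fun_prop
  · fun_prop

lemma kerK_prod (k t : ℝ) (hk : 0 < k) (h : ℝ → ℝ) (hh : IntegrableOn h (Ioc 0 t)) :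
    Integrable (fun p : ℝ × ℝ => kerK k p.1 p.2 * h p.2)
      ((volume.restrict (Ioc 0 t)).prod (volume.restrict (Ioc 0 t))) := by
  rw [integrable_prod_iff']
  · constructor
    · filter_upwards [ae_restrict_mem measurableSet_Ioc] with r hr
      exact (kerK_integrable k r t hr.1 hr.2).1.mul_const (h r)
    · have : Integrable (fun r => |h r| - (r / t) ^ k * |h r|) (volume.restrict (Ioc 0 t)) :=
        Integrable.sub hh.abs (weight_integrable k t hk _ hh.abs)
      refine this.congr ?_
      filter_upwards [ae_restrict_mem measurableSet_Ioc] with r hr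
      simp only [norm_mul, Real.norm_eq_abs, abs_of_nonneg (kerK_nonneg k _ r hk hr.1)]
      rw [integral_mul_const, (kerK_integrable k r t hr.1 hr.2).2]
      ring
  · exact (kerK_measurable k).aestronglyMeasurable.mul hh.aestronglyMeasurable.comp_snd

lemma kerK_inner (k t s : ℝ) (h : ℝ → ℝ) (hs : s ∈ Ioc 0 t) :
    ∫ r in Ioc 0 t, kerK k s r * h r = k * (lamPlus k h s / s) := by
  have e : ∫ r in Ioc 0 t, kerK k s r * h r
      = ∫ r in Ioc 0 t, (Iic s).indicator (fun r => (k / s) * ((r / s) ^ k * h r)) r := by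
    refine setIntegral_congr_fun measurableSet_Ioc ?_
    intro r hr
    by_cases hrs : r ≤ s
    · simp only [kerK, hrs, if_true, indicator, mem_Iic]
      rw [Real.div_rpow hr.1.le hs.1.le, Real.rpow_sub hs.1, Real.rpow_neg hs.1.le, Real.rpow_one]
      have := (Real.rpow_pos_of_pos hs.1 k).ne'
      have := hs.1.ne'
      field_simp
    · simp [kerK, hrs, indicator]
  have e2 : Ioc 0 t ∩ Iic s = Ioc 0 s := by
    rw [Ioc_inter_Iic, min_eq_right hs.2]
  rw [e, setIntegral_indicator measurableSet_Iic, e2, integral_const_mul, lamPlus]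
  ring

lemma lamPlus_div_integrable (k t : ℝ) (hk : 0 < k) (h : ℝ → ℝ)
    (hh : IntegrableOn h (Ioc 0 t)) :
    IntegrableOn (fun s => k * (lamPlus k h s / s)) (Ioc 0 t) := by
  refine (kerK_prod k t hk h hh).integral_prod_left.congr ?_
  filter_upwards [ae_restrict_mem measurableSet_Ioc] with s hs
  exact kerK_inner k t s h hs

lemma lamPlus_eq (k t : ℝ) (hk : 0 < k) (h : ℝ → ℝ)
    (hh : IntegrableOn h (Ioc 0 t)) :
    lamPlus k h t = ∫ s in Ioc 0 t, (h s - k * (lamPlus k h s / s)) := by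
  rw [integral_sub hh (lamPlus_div_integrable k t hk h hh),
    ← setIntegral_congr_fun measurableSet_Ioc (fun s hs => kerK_inner k t s h hs)]
  rw [integral_integral_swap (kerK_prod k t hk h hh)]
  have : ∫ r in Ioc 0 t, ∫ s in Ioc 0 t, kerK k s r * h r
      = ∫ r in Ioc 0 t, (h r - (r / t) ^ k * h r) := by
    refine setIntegral_congr_fun measurableSet_Ioc ?_
    intro r hr
    simp only
    rw [integral_mul_const, (kerK_integrable k r t hr.1 hr.2).2]
    ring
  rw [this, integral_sub hh (weight_integrable k t hk h hh), lamPlus]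
  ring

lemma lamPlus_continuousOn (k : ℝ) (hk : 0 < k) (h : ℝ → ℝ)
    (hh : IntegrableOn h (Ioc 0 1)) : ContinuousOn (lamPlus k h) (Icc 0 1) := by
  have hi : IntegrableOn (fun s => h s - k * (lamPlus k h s / s)) (Icc 0 1) := by
    rw [integrableOn_Icc_iff_integrableOn_Ioc]
    exact hh.sub (lamPlus_div_integrable k 1 hk h hh)
  refine (intervalIntegral.continuousOn_primitive hi).congr ?_
  intro t ht
  exact lamPlus_eq k t hk h (hh.mono_set (Ioc_subset_Ioc_right ht.2))

lemma zero_of_hom (k : ℝ) (hk : 0 < k) (z : ℝ → ℝ) (hz : ContinuousOn z (Icc 0 1))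
    (hi : IntegrableOn (fun s => z s / s) (Ioc 0 1))
    (he : ∀ t ∈ Icc (0:ℝ) 1, z t = ∫ s in Ioc 0 t, -(k * (z s / s))) :
    ∀ t ∈ Icc (0:ℝ) 1, z t = 0 := by
  intro t ht
  rcases ht.1.eq_or_lt with rfl | h0
  · rw [he 0 ht]; simp
  have hd : ∀ s ∈ Ioo 0 t, HasDerivAt (fun s => s ^ k * z s) 0 s := by
    intro s hs
    have hs1 : s < 1 := hs.2.trans_le ht.2
    have hcz : ∀ u ∈ Ioo (0:ℝ) 1, ContinuousAt (fun s => -(k * (z s / s))) u := by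
      intro u hu
      have := hz.continuousAt (Icc_mem_nhds hu.1 hu.2)
      exact ((this.div continuousAt_id hu.1.ne').const_mul k).neg
    have hii : IntervalIntegrable (fun s => -(k * (z s / s))) volume 0 s := by
      rw [intervalIntegrable_iff_integrableOn_Ioc_of_le hs.1.le]
      exact ((hi.mono_set (Ioc_subset_Ioc_right hs1.le)).const_mul k).neg
    have h1 : HasDerivAt (fun u => ∫ s in (0:ℝ)..u, -(k * (z s / s))) (-(k * (z s / s))) s := by
      refine intervalIntegral.integral_hasDerivAt_right hii ?_ (hcz s ⟨hs.1, hs1⟩)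
      exact ContinuousAt.stronglyMeasurableAtFilter isOpen_Ioo hcz s ⟨hs.1, hs1⟩
    have h2 : HasDerivAt z (-(k * (z s / s))) s := by
      refine h1.congr_of_eventuallyEq ?_
      filter_upwards [Icc_mem_nhds hs.1 hs1] with u hu
      rw [he u hu, intervalIntegral.integral_of_le hu.1]
    have h3 := (Real.hasDerivAt_rpow_const (p := k) (Or.inl hs.1.ne')).mul h2
    refine h3.congr_deriv ?_
    rw [Real.rpow_sub hs.1, Real.rpow_one]
    have := hs.1.ne'
    field_simp
    ring
  have hc : ContinuousOn (fun s => s ^ k * z s) (Icc 0 t) :=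
    (Real.continuous_rpow_const hk.le).continuousOn.mul (hz.mono (Icc_subset_Icc_right ht.2))
  obtain ⟨c, hc1, hc2⟩ := exists_hasDerivAt_eq_slope (fun s => s ^ k * z s) (fun _ => 0) h0 hc hd
  rw [Real.zero_rpow hk.ne', eq_div_iff (by linarith)] at hc2
  have := (Real.rpow_pos_of_pos h0 k).ne'
  have h4 : t ^ k * z t = 0 := by linarith
  exact (mul_eq_zero.1 h4).resolve_left this

/-- The solution property is equivalent to being `Λ₊ h`. -/
lemma sol_iff (k : ℝ) (hk : 0 < k) (x : ℝ → ℝ) (hx : ContinuousOn x (Icc 0 1)) (h : ℝ → ℝ)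
    (hh : IntegrableOn h (Ioc 0 1)) :
    (x 0 = 0 ∧ IntegrableOn (fun t => |x t| / t) (Ioc 0 1) ∧
      ∃ g : ℝ → ℝ, IntegrableOn g (Ioc 0 1) ∧
        (∀ t ∈ Icc (0:ℝ) 1, x t = ∫ s in Ioc (0:ℝ) t, g s) ∧
        (∀ᵐ t ∂(volume.restrict (Ioc (0:ℝ) 1)), g t = -(k / t) * x t + h t)) ↔
    ∀ t ∈ Icc (0:ℝ) 1, x t = lamPlus k h t := by
  have hL := lamPlus_div_integrable k 1 hk h hh
  have hL' : IntegrableOn (fun s => lamPlus k h s / s) (Ioc 0 1) := by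
    refine (Integrable.const_mul hL k⁻¹).congr (ae_of_all _ fun s => ?_)
    simp only
    rw [inv_mul_cancel_left₀ hk.ne']
  constructor
  · rintro ⟨-, h1, g, hg, hxg, hge⟩ t ht
    have hxi : IntegrableOn (fun s => x s / s) (Ioc 0 1) := by
      refine Integrable.mono' h1 ?_ ?_
      · exact ((hx.mono Ioc_subset_Icc_self).div continuousOn_id
          (fun s hs => hs.1.ne')).aestronglyMeasurable measurableSet_Ioc
      · filter_upwards [ae_restrict_mem measurableSet_Ioc] with s hs
        rw [norm_div, Real.norm_eq_abs, Real.norm_of_nonneg hs.1.le]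
    have key := zero_of_hom k hk (fun s => x s - lamPlus k h s)
      (hx.sub (lamPlus_continuousOn k hk h hh)) ?_ ?_ t ht
    · exact sub_eq_zero.1 key
    · refine (Integrable.sub hxi hL').congr (ae_of_all _ fun s => ?_)
      simp [sub_div]
    · intro t ht
      have hsub : Ioc (0:ℝ) t ⊆ Ioc 0 1 := Ioc_subset_Ioc_right ht.2
      have hsi : Integrable (fun s => h s - k * (lamPlus k h s / s))
          (volume.restrict (Ioc 0 t)) :=
        Integrable.sub (hh.mono_set hsub) (hL.mono_set hsub)
      rw [hxg t ht, lamPlus_eq k t hk h (hh.mono_set hsub), ← integral_sub (hg.mono_set hsub) hsi]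
      refine integral_congr_ae ?_
      filter_upwards [ae_restrict_of_ae_restrict_of_subset hsub hge] with s hs
      rw [hs]
      ring
  · intro he
    refine ⟨?_, ?_, fun s => h s - k * (lamPlus k h s / s), Integrable.sub hh hL, ?_, ?_⟩
    · rw [he 0 (by simp)]; simp [lamPlus]
    · refine hL'.norm.congr ?_
      filter_upwards [ae_restrict_mem measurableSet_Ioc] with s hs
      rw [he s ⟨hs.1.le, hs.2⟩, norm_div, Real.norm_eq_abs, Real.norm_of_nonneg hs.1.le]
    · intro t ht
      rw [he t ht]
      exact lamPlus_eq k t hk h (hh.mono_set (Ioc_subset_Ioc_right ht.2))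
    · filter_upwards [ae_restrict_mem measurableSet_Ioc] with s hs
      rw [he s ⟨hs.1.le, hs.2⟩]
      ring

/-- For `k > 0` and a linear bounded operator `T : C[0,1] → L¹(0,1)`, if the
spectral radius of `Λ₊T : C[0,1] → C[0,1]`, `(Λ₊f)(t) = ∫_0^t (s/t)^k f s ds`, is
less than `1`, then for every `f ∈ L¹(0,1)` the Cauchy problem
`x' = -(k/t)x + Tx + f`, `x 0 = 0` has a unique solution in
`D₊ = {x ∈ AC[0,1] : x 0 = 0, ∫_0^1 |x|/t < ∞}`. -/
theorem stmt_12 (k : ℝ) (hk : 0 < k)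
    (T : C(Icc (0:ℝ) 1, ℝ) → ℝ → ℝ) (hTlin : IsLinearMap ℝ T)
    (hTint : ∀ u, IntegrableOn (T u) (Ioc 0 1))
    (hTbdd : ∃ M : ℝ, ∀ u, (∫ t in Ioc (0:ℝ) 1, |T u t|) ≤ M * ‖u‖)
    (S : C(Icc (0:ℝ) 1, ℝ) →L[ℝ] C(Icc (0:ℝ) 1, ℝ))
    (hS : ∀ (u : C(Icc (0:ℝ) 1, ℝ)) (t : Icc (0:ℝ) 1),
      S u t = ∫ s in Ioc (0:ℝ) (t:ℝ), (s / (t:ℝ)) ^ k * T u s)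
    (hρ : spectralRadius ℝ S < 1)
    (f : ℝ → ℝ) (hf : IntegrableOn f (Ioc 0 1)) :
    ∃! x : C(Icc (0:ℝ) 1, ℝ),
      (Set.IccExtend (by norm_num : (0:ℝ) ≤ 1) x) 0 = 0 ∧
      IntegrableOn
        (fun t => |Set.IccExtend (by norm_num : (0:ℝ) ≤ 1) x t| / t) (Ioc 0 1) ∧
      ∃ g : ℝ → ℝ, IntegrableOn g (Ioc 0 1) ∧
        (∀ t ∈ Icc (0:ℝ) 1,
          Set.IccExtend (by norm_num : (0:ℝ) ≤ 1) x t = ∫ s in Ioc (0:ℝ) t, g s) ∧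
        (∀ᵐ t ∂(volume.restrict (Ioc (0:ℝ) 1)),
          g t = -(k / t) * Set.IccExtend (by norm_num : (0:ℝ) ≤ 1) x t
            + T x t + f t) := by
  let F : C(Icc (0:ℝ) 1, ℝ) := ⟨fun t => lamPlus k f t,
    continuousOn_iff_continuous_restrict.1 (lamPlus_continuousOn k hk f hf)⟩
  have hiff : ∀ x : C(Icc (0:ℝ) 1, ℝ),
      ((Set.IccExtend (by norm_num : (0:ℝ) ≤ 1) x) 0 = 0 ∧
      IntegrableOn
        (fun t => |Set.IccExtend (by norm_num : (0:ℝ) ≤ 1) x t| / t) (Ioc 0 1) ∧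
      ∃ g : ℝ → ℝ, IntegrableOn g (Ioc 0 1) ∧
        (∀ t ∈ Icc (0:ℝ) 1,
          Set.IccExtend (by norm_num : (0:ℝ) ≤ 1) x t = ∫ s in Ioc (0:ℝ) t, g s) ∧
        (∀ᵐ t ∂(volume.restrict (Ioc (0:ℝ) 1)),
          g t = -(k / t) * Set.IccExtend (by norm_num : (0:ℝ) ≤ 1) x t
            + T x t + f t)) ↔ (1 - S) x = F := by
    intro x
    have hx : Continuous (Set.IccExtend (by norm_num : (0:ℝ) ≤ 1) x) := x.continuous.Icc_extend'
    have := sol_iff k hk _ hx.continuousOn (fun t => T x t + f t) (Integrable.add (hTint x) hf)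
    simp only [← add_assoc] at this
    rw [this]
    have hadd : ∀ t : Icc (0:ℝ) 1, lamPlus k (fun t => T x t + f t) t = S x t + F t := by
      intro t
      have hsub : Ioc (0:ℝ) t ⊆ Ioc 0 1 := Ioc_subset_Ioc_right t.2.2
      rw [hS]
      change _ = _ + lamPlus k f t
      unfold lamPlus
      rw [← integral_add (weight_integrable k t hk _ ((hTint x).mono_set hsub))
        (weight_integrable k t hk _ (hf.mono_set hsub))]
      simp only [mul_add]
    constructor
    · intro h
      ext t
      have h1 := h t t.2
      rw [hadd, IccExtend_val] at h1
      simp [h1]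
    · intro h t ht
      have h1 := hadd ⟨t, ht⟩
      simp only at h1
      rw [h1, IccExtend_of_mem _ _ ht, ← h]
      simp
  have hres : (1:ℝ) ∈ resolventSet ℝ S :=
    spectrum.mem_resolventSet_of_spectralRadius_lt (by simpa using hρ)
  rw [spectrum.mem_resolventSet_iff, map_one] at hres
  obtain ⟨U, hU⟩ := hres
  simp only [hiff, ← hU]
  refine ⟨(U⁻¹ : (C(Icc (0:ℝ) 1, ℝ) →L[ℝ] C(Icc (0:ℝ) 1, ℝ))ˣ).1 F, ?_, ?_⟩
  · change (U.1 * (U⁻¹).1) F = F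
    rw [Units.mul_inv]; rfl
  · intro y hy
    rw [← hy]
    change y = ((U⁻¹).1 * U.1) y
    rw [Units.inv_mul]; rfl
end

section
/- Let T⁺, T⁻ ≥ 0 be real numbers with T⁺ ≤ 1 and T⁻ ≤ 2√(1 - T⁺). Let k > 0 and let T = T⁺op - T⁻op where T⁺op, T⁻op : C[0,1] → L¹(0,1) are linear positive operators with ‖T⁺op‖ = T⁺ and ‖T⁻op‖ = T⁻. Then the Cauchy problem x' = -(k/t)x + Tx + f, x(0) = 0, has a unique solution in D₊ for every f ∈ L¹(0,1). -/
open MeasureTheory Set Filter Topology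

structure PosOp14 (T : C(Icc (0:ℝ) 1, ℝ) → ℝ → ℝ) : Prop where
  lin : IsLinearMap ℝ T
  int : ∀ u, IntegrableOn (T u) (Ioc 0 1)
  pos : ∀ u : C(Icc (0:ℝ) 1, ℝ), (∀ t, 0 ≤ u t) →
      ∀ᵐ t ∂(volume.restrict (Ioc (0:ℝ) 1)), 0 ≤ T u t

lemma PosOp14.le_of {T} (hT : PosOp14 T) (x : C(Icc (0:ℝ) 1, ℝ)) (M : ℝ) (h : ∀ t, x t ≤ M) :
    ∀ᵐ t ∂(volume.restrict (Ioc (0:ℝ) 1)), T x t ≤ M * T 1 t := by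
  have := hT.pos (M • 1 - x) (by intro t; simpa using h t)
  rw [hT.lin.map_sub, hT.lin.map_smul] at this
  filter_upwards [this] with t ht
  simpa using ht

lemma PosOp14.ge_of {T} (hT : PosOp14 T) (x : C(Icc (0:ℝ) 1, ℝ)) (m : ℝ) (h : ∀ t, -m ≤ x t) :
    ∀ᵐ t ∂(volume.restrict (Ioc (0:ℝ) 1)), -(m * T 1 t) ≤ T x t := by
  have := hT.pos (x + m • 1) (by intro t; have := h t; simp; linarith)
  rw [hT.lin.map_add, hT.lin.map_smul] at this
  filter_upwards [this] with t ht
  simp at ht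
  linarith

lemma last_zero14 (X : ℝ → ℝ) (hX : Continuous X) (a b : ℝ) (hab : a ≤ b) (ha : X a ≤ 0)
    (hb : 0 < X b) : ∃ t0, a ≤ t0 ∧ t0 < b ∧ X t0 ≤ 0 ∧ ∀ s, t0 < s → s ≤ b → 0 < X s := by
  have hc : IsCompact (Icc a b ∩ {s | X s ≤ 0}) :=
    isCompact_Icc.inter_right (isClosed_le hX continuous_const)
  obtain ⟨t0, ⟨h1, h2⟩, h3⟩ := hc.exists_isGreatest ⟨a, ⟨le_refl a, hab⟩, ha⟩
  refine ⟨t0, h1.1, lt_of_le_of_ne h1.2 ?_, h2, ?_⟩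
  · rintro rfl
    exact absurd h2 (not_le.2 hb)
  · intro s hs hsb
    by_contra hcon
    exact absurd (h3 ⟨⟨h1.1.trans hs.le, hsb⟩, not_lt.1 hcon⟩) (not_le.2 hs)

/-- homogeneous/inhomogeneous integral equation -/
def Sol14 (k : ℝ) (Tp Tm : C(Icc (0:ℝ) 1, ℝ) → ℝ → ℝ) (x : C(Icc (0:ℝ) 1, ℝ)) : Prop :=
  ∃ g : ℝ → ℝ, IntegrableOn g (Ioc 0 1) ∧
        (∀ t ∈ Icc (0:ℝ) 1,
          Set.IccExtend (by norm_num : (0:ℝ) ≤ 1) x t = ∫ s in Ioc (0:ℝ) t, g s) ∧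
        (∀ᵐ t ∂(volume.restrict (Ioc (0:ℝ) 1)),
          g t = -(k / t) * Set.IccExtend (by norm_num : (0:ℝ) ≤ 1) x t
            + (Tp x t - Tm x t))

lemma IccExtend_neg14 (x : C(Icc (0:ℝ) 1, ℝ)) (t : ℝ) :
    Set.IccExtend (by norm_num : (0:ℝ) ≤ 1) (⇑(-x)) t
      = - Set.IccExtend (by norm_num : (0:ℝ) ≤ 1) (⇑x) t := by
  simp [IccExtend]

lemma IccExtend_sub14 (x y : C(Icc (0:ℝ) 1, ℝ)) (t : ℝ) :
    Set.IccExtend (by norm_num : (0:ℝ) ≤ 1) (⇑(x - y)) t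
      = Set.IccExtend (by norm_num : (0:ℝ) ≤ 1) (⇑x) t
        - Set.IccExtend (by norm_num : (0:ℝ) ≤ 1) (⇑y) t := by
  simp [IccExtend]

lemma Sol14.neg {k Tp Tm x} (hp : PosOp14 Tp) (hm : PosOp14 Tm) (h : Sol14 k Tp Tm x) :
    Sol14 k Tp Tm (-x) := by
  obtain ⟨g, h1, h2, h3⟩ := h
  refine ⟨-g, h1.neg, ?_, ?_⟩
  · intro t ht
    rw [IccExtend_neg14, h2 t ht]
    simp [integral_neg]
  · filter_upwards [h3] with t ht
    rw [IccExtend_neg14, hp.lin.map_neg, hm.lin.map_neg]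
    simp only [Pi.neg_apply, ht]
    ring

lemma diff14 (g : ℝ → ℝ) (hg : IntegrableOn g (Ioc 0 1)) (s t : ℝ) (hs : 0 ≤ s) (hst : s ≤ t)
    (ht : t ≤ 1) : (∫ r in Ioc 0 t, g r) - (∫ r in Ioc 0 s, g r) = ∫ r in Ioc s t, g r := by
  rw [← Ioc_union_Ioc_eq_Ioc hs hst, setIntegral_union (Ioc_disjoint_Ioc_of_le le_rfl)
    measurableSet_Ioc (hg.mono_set (Ioc_subset_Ioc_right (hst.trans ht)))
    (hg.mono_set (Ioc_subset_Ioc hs ht))]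
  ring

lemma peak14 {k : ℝ} (hk : 0 < k) {Tp Tm x} (hp : PosOp14 Tp) (hm : PosOp14 Tm)
    (h : Sol14 k Tp Tm x) (M m : ℝ) (hM : 0 < M) (hm0 : 0 ≤ m) (hle : ∀ t, x t ≤ M)
    (hge : ∀ t, -m ≤ x t) (a b : ℝ) (ha : 0 ≤ a) (hab : a ≤ b) (hb : b ≤ 1)
    (hxa : Set.IccExtend (by norm_num : (0:ℝ) ≤ 1) x a ≤ 0)
    (hxb : Set.IccExtend (by norm_num : (0:ℝ) ≤ 1) x b = M) :
    M < M * (∫ s in Ioc a b, Tp 1 s) + m * (∫ s in Ioc a b, Tm 1 s) := by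
  obtain ⟨g, h1, h2, h3⟩ := h
  set X := Set.IccExtend (by norm_num : (0:ℝ) ≤ 1) x with hX
  have hXc : Continuous X := x.continuous.Icc_extend'
  obtain ⟨t0, hat, htb, hXt, hpos⟩ := last_zero14 X hXc a b hab hxa (by rw [hxb]; exact hM)
  have e1 : M ≤ ∫ s in Ioc t0 b, g s := by
    rw [← diff14 g h1 t0 b (ha.trans hat) htb.le hb, ← h2 b ⟨ha.trans hab, hb⟩,
      ← h2 t0 ⟨ha.trans hat, htb.le.trans hb⟩, hxb]
    linarith
  set φ : ℝ → ℝ := fun s => M * Tp 1 s + m * Tm 1 s with hφ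
  have hφi : IntegrableOn φ (Ioc 0 1) := ((hp.int 1).const_mul M).add ((hm.int 1).const_mul m)
  have sub1 : Ioc a b ⊆ Ioc 0 1 := Ioc_subset_Ioc ha hb
  have sub0 : Ioc t0 b ⊆ Ioc a b := Ioc_subset_Ioc_left hat
  have hlt : ∀ᵐ s ∂(volume.restrict (Ioc t0 b)), g s < φ s := by
    have hall : ∀ᵐ s ∂(volume.restrict (Ioc (0:ℝ) 1)), g s ≤ φ s - (k / s) * X s := by
      filter_upwards [h3, hp.le_of x M hle, hm.ge_of x m hge] with s a1 a2 a3
      rw [a1]; simp only [hφ]; linarith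
    filter_upwards [ae_restrict_of_ae_restrict_of_subset (sub0.trans sub1) hall,
      ae_restrict_mem measurableSet_Ioc] with s a1 a2
    have : 0 < k / s * X s :=
      mul_pos (div_pos hk ((ha.trans hat).trans_lt a2.1)) (hpos s a2.1 a2.2)
    linarith
  have hφ0 : ∀ᵐ s ∂(volume.restrict (Ioc a b)), 0 ≤ φ s := by
    filter_upwards [ae_restrict_of_ae_restrict_of_subset sub1 (hp.pos 1 (by simp)),
      ae_restrict_of_ae_restrict_of_subset sub1 (hm.pos 1 (by simp))] with s a1 a2
    simp only [hφ]; positivity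
  have gi := h1.mono_set (sub0.trans sub1)
  have φi := hφi.mono_set (sub0.trans sub1)
  have e2 : ∫ s in Ioc t0 b, g s < ∫ s in Ioc t0 b, φ s := by
    have : 0 < ∫ s in Ioc t0 b, (φ - g) s := by
      rw [integral_pos_iff_support_of_nonneg_ae _ (φi.sub gi)]
      · rw [pos_iff_ne_zero]
        intro h0
        have hv : (volume.restrict (Ioc t0 b)) univ = 0 := by
          have hu : (volume.restrict (Ioc t0 b)) ((Function.support (φ - g))ᶜ) = 0 := by
            have : ∀ᵐ s ∂(volume.restrict (Ioc t0 b)), s ∈ Function.support (φ - g) := by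
              filter_upwards [hlt] with s hs
              simp only [Function.mem_support, Pi.sub_apply]; linarith
            exact this
          rw [← union_compl_self (Function.support (φ - g))]
          exact measure_union_null h0 hu
        simp at hv
        linarith
      · filter_upwards [hlt] with s hs
        simp only [Pi.zero_apply, Pi.sub_apply]; linarith
    simp only [Pi.sub_apply] at this
    rw [integral_sub φi gi] at this
    linarith
  have e3 : ∫ s in Ioc t0 b, φ s ≤ ∫ s in Ioc a b, φ s :=
    setIntegral_mono_set (hφi.mono_set sub1) hφ0 sub0.eventuallyLE
  have e4 : ∫ s in Ioc a b, φ s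
      = M * (∫ s in Ioc a b, Tp 1 s) + m * (∫ s in Ioc a b, Tm 1 s) := by
    simp only [hφ]
    rw [integral_add (((hp.int 1).mono_set sub1).const_mul M)
      (((hm.int 1).mono_set sub1).const_mul m), integral_const_mul, integral_const_mul]
  linarith

lemma part14 {T} (hT : PosOp14 T) (a b c : ℝ) (ha : 0 ≤ a) (hab : a ≤ b) (hbc : b ≤ c)
    (hc : c ≤ 1) : 0 ≤ (∫ s in Ioc a b, T 1 s) ∧
      (∫ s in Ioc a b, T 1 s) + (∫ s in Ioc b c, T 1 s) ≤ ∫ s in Ioc 0 1, T 1 s := by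
  have h0 := hT.pos 1 (by simp)
  have hi := hT.int 1
  constructor
  · exact integral_nonneg_of_ae
      (ae_restrict_of_ae_restrict_of_subset (Ioc_subset_Ioc ha (hbc.trans hc)) h0)
  · rw [← setIntegral_union (Ioc_disjoint_Ioc_of_le le_rfl) measurableSet_Ioc
      (hi.mono_set (Ioc_subset_Ioc ha (hbc.trans hc)))
      (hi.mono_set (Ioc_subset_Ioc (ha.trans hab) hc)), Ioc_union_Ioc_eq_Ioc hab hbc]
    exact setIntegral_mono_set hi h0 (Ioc_subset_Ioc ha hc).eventuallyLE

lemma ordered14 {k : ℝ} (hk : 0 < k) {Tp Tm x} (hp : PosOp14 Tp) (hm : PosOp14 Tm)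
    (P N : ℝ) (h1 : P ≤ 1) (h2 : N ≤ 2 * Real.sqrt (1 - P)) 
    (hP : (∫ t in Ioc (0:ℝ) 1, Tp 1 t) = P) (hN : (∫ t in Ioc (0:ℝ) 1, Tm 1 t) = N)
    (h : Sol14 k Tp Tm x) (M m : ℝ) (hM : 0 < M) (hm0 : 0 < m) (hle : ∀ t, x t ≤ M)
    (hge : ∀ t, -m ≤ x t) (a b : ℝ) (ha : 0 ≤ a) (hab : a ≤ b) (hb : b ≤ 1)
    (hx0 : Set.IccExtend (by norm_num : (0:ℝ) ≤ 1) x 0 = 0)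
    (hxa : Set.IccExtend (by norm_num : (0:ℝ) ≤ 1) x a = -m)
    (hxb : Set.IccExtend (by norm_num : (0:ℝ) ≤ 1) x b = M) : False := by
  have p1 := peak14 hk hp hm h M m hM hm0.le hle hge a b ha hab hb (by linarith) hxb
  have p2 := peak14 hk hp hm (h.neg hp hm) m M hm0 hM.le (by intro t; have := hge t; simp; linarith)
    (by intro t; have := hle t; simp; linarith) 0 a le_rfl ha (hab.trans hb)
    (by rw [IccExtend_neg14]; linarith) (by rw [IccExtend_neg14]; linarith)
  obtain ⟨q1, q2⟩ := part14 hp 0 a b le_rfl ha hab hb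
  obtain ⟨q3, -⟩ := part14 hp a b b ha hab le_rfl hb
  obtain ⟨r1, r2⟩ := part14 hm 0 a b le_rfl ha hab hb
  obtain ⟨r3, -⟩ := part14 hm a b b ha hab le_rfl hb
  rw [hP] at q2
  rw [hN] at r2
  generalize (∫ s in Ioc 0 a, Tp 1 s) = B1 at *
  generalize (∫ s in Ioc a b, Tp 1 s) = B2 at *
  generalize (∫ s in Ioc 0 a, Tm 1 s) = A1 at *
  generalize (∫ s in Ioc a b, Tm 1 s) = A2 at *
  have hsq := Real.sq_sqrt (show 0 ≤ 1 - P by linarith)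
  have hs0 := Real.sqrt_nonneg (1 - P)
  set q := Real.sqrt (1 - P)
  have u1 : M * (1 - B2) < m * A2 := by linarith
  have u2 : m * (1 - B1) < M * A1 := by linarith
  have u3 : (M * (1 - B2)) * (m * (1 - B1)) < (m * A2) * (M * A1) :=
    mul_lt_mul'' u1 u2 (mul_nonneg hM.le (by linarith)) (mul_nonneg hm0.le (by linarith))
  have u4 : (1 - B2) * (1 - B1) < A2 * A1 := by
    have : 0 < M * m := mul_pos hM hm0
    nlinarith
  nlinarith [mul_nonneg q1 q3, sq_nonneg (A1 - A2)]

lemma uniq14 {k : ℝ} (hk : 0 < k) {Tp Tm x} (hp : PosOp14 Tp) (hm : PosOp14 Tm)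
    (P N : ℝ) (h1 : P ≤ 1) (h2 : N ≤ 2 * Real.sqrt (1 - P)) 
    (hP : (∫ t in Ioc (0:ℝ) 1, Tp 1 t) = P) (hN : (∫ t in Ioc (0:ℝ) 1, Tm 1 t) = N)
    (h : Sol14 k Tp Tm x) : x = 0 := by
  have hx0 : Set.IccExtend (by norm_num : (0:ℝ) ≤ 1) x 0 = 0 := by
    obtain ⟨g, -, h2, -⟩ := h
    rw [h2 0 (by simp)]; simp
  have hx0' : x ⟨0, by simp⟩ = 0 := by
    rwa [IccExtend_of_mem _ _ (by simp : (0:ℝ) ∈ Icc (0:ℝ) 1)] at hx0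
  have hval : ∀ t : Icc (0:ℝ) 1, Set.IccExtend (by norm_num : (0:ℝ) ≤ 1) x t = x t := fun t =>
    IccExtend_val _ _ t
  obtain ⟨b, -, hbM⟩ := isCompact_univ.exists_isMaxOn (univ_nonempty) x.continuous.continuousOn
  obtain ⟨a, -, ham⟩ := isCompact_univ.exists_isMinOn (univ_nonempty) x.continuous.continuousOn
  have hle : ∀ t, x t ≤ x b := fun t => hbM (mem_univ t)
  have hge : ∀ t, x a ≤ x t := fun t => ham (mem_univ t)
  have hM0 : 0 ≤ x b := hx0'.symm.le.trans (hle _)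
  have hm0 : x a ≤ 0 := (hge _).trans hx0'.le
  have hpart := fun c : Icc (0:ℝ) 1 => part14 hp 0 c c le_rfl c.2.1 le_rfl c.2.2
  rw [hP] at hpart
  simp at hpart
  -- if max positive then min negative
  have c1 : 0 < x b → x a < 0 := by
    intro hb
    by_contra hcon
    have h0 : x a = 0 := le_antisymm hm0 (not_lt.1 hcon)
    have := peak14 hk hp hm h (x b) 0 hb le_rfl hle (by intro t; have := hge t; linarith) 0 b
      le_rfl b.2.1 b.2.2 hx0.le (hval b)
    have := (hpart b b.2.1 b.2.2).2
    nlinarith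
  have c2 : x a < 0 → 0 < x b := by
    intro ha
    by_contra hcon
    have h0 : x b = 0 := le_antisymm (not_lt.1 hcon) hM0
    have := peak14 hk hp hm (h.neg hp hm) (- x a) 0 (by linarith) le_rfl
      (by intro t; have := hge t; simp; linarith) (by intro t; have := hle t; simp; linarith) 0 a
      le_rfl a.2.1 a.2.2 (by rw [IccExtend_neg14]; linarith) (by rw [IccExtend_neg14, hval])
    have := (hpart a a.2.1 a.2.2).2
    nlinarith
  by_cases hb : 0 < x b
  · exfalso
    have ha := c1 hb
    rcases le_total a.1 b.1 with hab | hab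
    · exact ordered14 hk hp hm P N h1 h2 hP hN h (x b) (- x a) hb (by linarith) hle
        (by simpa using hge) a b a.2.1 hab b.2.2 hx0 (by rw [hval]; ring) (hval b)
    · exact ordered14 hk hp hm P N h1 h2 hP hN (h.neg hp hm) (- x a) (x b) (by linarith) hb
        (by simpa using hge) (by simpa using hle) b a b.2.1 hab a.2.2
        (by rw [IccExtend_neg14]; linarith) (by rw [IccExtend_neg14, hval])
        (by rw [IccExtend_neg14, hval])
  · ext t
    have ha : ¬ x a < 0 := fun h => hb (c2 h)
    have := hle t
    have := hge t
    simp
    linarith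

lemma kerInner14 (k : ℝ) (hk : 0 < k) (t r c : ℝ) (hr : 0 < r) (hrt : r ≤ t) :
    IntegrableOn ((Ici r).indicator (fun s => k * s ^ (-k-1) * c)) (Ioc 0 t) ∧
    ∫ s in Ioc 0 t, (Ici r).indicator (fun s => k * s ^ (-k-1) * c) s
      = c * (r ^ (-k) - t ^ (-k)) := by
  have hset : Ioc 0 t ∩ Ici r = Icc r t := by
    ext s; simp only [mem_inter_iff, mem_Ioc, mem_Ici, mem_Icc]
    constructor
    · rintro ⟨⟨a, b⟩, c⟩; exact ⟨c, b⟩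
    · rintro ⟨a, b⟩; exact ⟨⟨hr.trans_le a, b⟩, a⟩
  constructor
  · rw [IntegrableOn, integrable_indicator_iff measurableSet_Ici, IntegrableOn,
      Measure.restrict_restrict measurableSet_Ici, inter_comm, hset]
    apply ContinuousOn.integrableOn_Icc
    refine ContinuousOn.mul (continuousOn_const.mul ?_) continuousOn_const
    exact continuousOn_id.rpow_const (fun x hx => Or.inl (hr.trans_le hx.1).ne')
  · rw [setIntegral_indicator measurableSet_Ici, hset, integral_Icc_eq_integral_Ioc,
      ← intervalIntegral.integral_of_le hrt, intervalIntegral.integral_mul_const,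
      intervalIntegral.integral_const_mul, integral_rpow]
    · have : -k - 1 + 1 = -k := by ring
      rw [this]; field_simp; ring
    · right
      refine ⟨by linarith, ?_⟩
      rw [uIcc_of_le hrt]
      simp [hr]

lemma rpowInt14 (k : ℝ) (hk : 0 < k) (h : ℝ → ℝ) (hh : IntegrableOn h (Ioc 0 1)) :
    IntegrableOn (fun r => r ^ k * h r) (Ioc 0 1) := by
  refine hh.bdd_mul (c := 1) (by fun_prop) ?_
  filter_upwards [ae_restrict_mem measurableSet_Ioc] with r hr
  rw [Real.norm_of_nonneg (Real.rpow_nonneg hr.1.le _)]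
  exact Real.rpow_le_one hr.1.le hr.2 hk.le

lemma ker14 (k : ℝ) (hk : 0 < k) (h : ℝ → ℝ) (hh : IntegrableOn h (Ioc 0 1)) (t : ℝ) (ht : 0 < t)
    (ht1 : t ≤ 1) :
    IntegrableOn (fun s => k * s ^ (-k-1) * ∫ r in Ioc 0 s, r ^ k * h r) (Ioc 0 t) ∧
    ∫ s in Ioc 0 t, (k * s ^ (-k-1) * ∫ r in Ioc 0 s, r ^ k * h r)
      = (∫ r in Ioc 0 t, h r) - t ^ (-k) * ∫ r in Ioc 0 t, r ^ k * h r := by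
  set μ := volume.restrict (Ioc 0 t) with hμ
  have sub : Ioc 0 t ⊆ Ioc 0 1 := Ioc_subset_Ioc_right ht1
  have hi : Integrable h μ := hh.mono_set sub
  have hri : Integrable (fun r => r ^ k * h r) μ := (rpowInt14 k hk h hh).mono_set sub
  set F : ℝ → ℝ → ℝ := fun s r => (Ici r).indicator (fun s => k * s ^ (-k-1) * (r ^ k * h r)) s
    with hF
  have hFm : AEStronglyMeasurable (Function.uncurry F) (μ.prod μ) := by
    have e : Function.uncurry F = ({p : ℝ × ℝ | p.2 ≤ p.1}).indicator
        (fun p => k * p.1 ^ (-k-1) * (p.2 ^ k * h p.2)) := by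
      ext ⟨s, r⟩
      simp [F, Function.uncurry, indicator]
    rw [e]
    refine AEStronglyMeasurable.indicator ?_ (measurableSet_le measurable_snd measurable_fst)
    refine AEStronglyMeasurable.mul ?_ hri.aestronglyMeasurable.comp_snd
    exact Measurable.aestronglyMeasurable (by fun_prop)
  have hcancel : ∀ r ∈ Ioc 0 t, ∀ c, r ^ k * c * (r ^ (-k) - t ^ (-k))
      = c - t ^ (-k) * (r ^ k * c) := by
    intro r hr c
    have : r ^ k * r ^ (-k) = 1 := by rw [← Real.rpow_add hr.1]; simp
    linear_combination c * this
  have hFi : Integrable (Function.uncurry F) (μ.prod μ) := by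
    rw [integrable_prod_iff' hFm]
    constructor
    · filter_upwards [ae_restrict_mem measurableSet_Ioc] with r hr
      exact (kerInner14 k hk t r (r ^ k * h r) hr.1 hr.2).1
    · have : Integrable (fun r => |h r| - t ^ (-k) * (r ^ k * |h r|)) μ := by
        refine hi.abs.sub (Integrable.const_mul ?_ _)
        exact (rpowInt14 k hk (fun r => |h r|) hh.abs).mono_set sub
      refine this.congr ?_
      filter_upwards [ae_restrict_mem measurableSet_Ioc] with r hr
      rw [← hcancel r hr, ← (kerInner14 k hk t r (r ^ k * |h r|) hr.1 hr.2).2]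
      refine setIntegral_congr_fun measurableSet_Ioc ?_
      intro s hs
      simp only [Function.uncurry, F, indicator]
      split_ifs
      · rw [Real.norm_eq_abs, abs_mul, abs_mul, abs_mul, abs_of_pos hk,
          abs_of_nonneg (Real.rpow_nonneg hs.1.le _), abs_of_nonneg (Real.rpow_nonneg hr.1.le _)]
      · simp
  have hinner : ∀ s ∈ Ioc 0 t, ∫ r, F s r ∂μ = k * s ^ (-k-1) * ∫ r in Ioc 0 s, r ^ k * h r := by
    intro s hs
    rw [← integral_const_mul]
    have : F s = (Iic s).indicator (fun r => k * s ^ (-k-1) * (r ^ k * h r)) := by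
      ext r; simp [F, indicator]
    rw [this, hμ, setIntegral_indicator measurableSet_Iic]
    congr 2
    ext r; simp only [mem_inter_iff, mem_Ioc, mem_Iic]
    constructor
    · rintro ⟨⟨a, b⟩, c⟩; exact ⟨a, c⟩
    · rintro ⟨a, b⟩; exact ⟨⟨a, b.trans hs.2⟩, b⟩
  have hae : (fun s => ∫ r, F s r ∂μ) =ᵐ[μ]
      fun s => k * s ^ (-k-1) * ∫ r in Ioc 0 s, r ^ k * h r := by
    filter_upwards [ae_restrict_mem measurableSet_Ioc] with s hs using hinner s hs
  refine ⟨(hFi.integral_prod_left).congr hae, ?_⟩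
  rw [← integral_congr_ae hae, integral_integral_swap hFi, ← integral_const_mul,
    ← integral_sub hi (hri.const_mul _)]
  refine setIntegral_congr_fun measurableSet_Ioc ?_
  intro r hr
  simp only
  rw [← hcancel r hr, ← (kerInner14 k hk t r (r ^ k * h r) hr.1 hr.2).2]

/-- derivative of the solution of the model equation -/
noncomputable def G14 (k : ℝ) (h : ℝ → ℝ) (s : ℝ) : ℝ :=
  h s - k * s ^ (-k-1) * ∫ r in Ioc 0 s, r ^ k * h r

lemma G14_int (k : ℝ) (hk : 0 < k) (h : ℝ → ℝ) (hh : IntegrableOn h (Ioc 0 1)) :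
    IntegrableOn (G14 k h) (Ioc 0 1) :=
  hh.sub (ker14 k hk h hh 1 one_pos le_rfl).1

lemma G14_val (k : ℝ) (hk : 0 < k) (h : ℝ → ℝ) (hh : IntegrableOn h (Ioc 0 1)) (t : ℝ)
    (ht : 0 < t) (ht1 : t ≤ 1) :
    ∫ s in Ioc 0 t, G14 k h s = t ^ (-k) * ∫ r in Ioc 0 t, r ^ k * h r := by
  obtain ⟨a, b⟩ := ker14 k hk h hh t ht ht1
  simp only [G14]
  rw [integral_sub (hh.mono_set (Ioc_subset_Ioc_right ht1)) a, b]
  ring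

lemma G14_eq (k : ℝ) (hk : 0 < k) (h : ℝ → ℝ) (hh : IntegrableOn h (Ioc 0 1)) (t : ℝ)
    (ht : 0 < t) (ht1 : t ≤ 1) :
    G14 k h t = h t - k / t * ∫ s in Ioc 0 t, G14 k h s := by
  rw [G14_val k hk h hh t ht ht1, G14, Real.rpow_sub_one ht.ne']
  ring

lemma G14_add (k : ℝ) (hk : 0 < k) (h h' : ℝ → ℝ) (hh : IntegrableOn h (Ioc 0 1))
    (hh' : IntegrableOn h' (Ioc 0 1)) (t : ℝ) (ht1 : t ≤ 1) :
    G14 k (h + h') t = G14 k h t + G14 k h' t := by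
  have e : (fun r => r ^ k * (h + h') r) = fun r => r ^ k * h r + r ^ k * h' r := by
    ext r; simp; ring
  simp only [G14]
  rw [e, integral_add ((rpowInt14 k hk h hh).mono_set (Ioc_subset_Ioc_right ht1))
    ((rpowInt14 k hk h' hh').mono_set (Ioc_subset_Ioc_right ht1))]
  simp only [Pi.add_apply]
  ring

lemma G14_smul (k : ℝ) (c : ℝ) (h : ℝ → ℝ) (t : ℝ) :
    G14 k (c • h) t = c * G14 k h t := by
  have e : (fun r => r ^ k * (c • h) r) = fun r => c * (r ^ k * h r) := by
    ext r; simp; ring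
  simp only [G14]
  rw [e, integral_const_mul]
  simp only [Pi.smul_apply, smul_eq_mul]
  ring

/-- majorant of `G14` -/
noncomputable def H14 (k : ℝ) (φ : ℝ → ℝ) (s : ℝ) : ℝ :=
  φ s + k * s ^ (-k-1) * ∫ r in Ioc 0 s, r ^ k * φ r

lemma H14_int (k : ℝ) (hk : 0 < k) (h : ℝ → ℝ) (hh : IntegrableOn h (Ioc 0 1)) :
    IntegrableOn (H14 k h) (Ioc 0 1) :=
  hh.add (ker14 k hk h hh 1 one_pos le_rfl).1

lemma G14_le (k : ℝ) (hk : 0 < k) (h φ : ℝ → ℝ)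
    (hφ : IntegrableOn φ (Ioc 0 1))
    (hle : ∀ᵐ s ∂(volume.restrict (Ioc (0:ℝ) 1)), |h s| ≤ φ s) :
    ∀ᵐ s ∂(volume.restrict (Ioc (0:ℝ) 1)), |G14 k h s| ≤ H14 k φ s := by
  filter_upwards [hle, ae_restrict_mem measurableSet_Ioc] with s hs hs1
  have sub : Ioc 0 s ⊆ Ioc 0 1 := Ioc_subset_Ioc_right hs1.2
  have e : |∫ r in Ioc 0 s, r ^ k * h r| ≤ ∫ r in Ioc 0 s, r ^ k * φ r := by
    rw [← Real.norm_eq_abs]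
    refine norm_integral_le_of_norm_le ((rpowInt14 k hk φ hφ).mono_set sub) ?_
    filter_upwards [ae_restrict_of_ae_restrict_of_subset sub hle,
      ae_restrict_mem measurableSet_Ioc] with r hr hr1
    rw [Real.norm_eq_abs, abs_mul, abs_of_nonneg (Real.rpow_nonneg hr1.1.le _)]
    exact mul_le_mul_of_nonneg_left hr (Real.rpow_nonneg hr1.1.le _)
  have hc : 0 ≤ k * s ^ (-k-1) := mul_nonneg hk.le (Real.rpow_nonneg hs1.1.le _)
  rw [G14, H14]
  refine (abs_sub _ _).trans (add_le_add hs ?_)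
  rw [abs_mul, abs_of_nonneg hc]
  exact mul_le_mul_of_nonneg_left e hc

lemma contPrim14 (g : ℝ → ℝ) (hg : IntegrableOn g (Ioc 0 1)) :
    Continuous (fun t : Icc (0:ℝ) 1 => ∫ s in Ioc 0 t.1, g s) := by
  have := intervalIntegral.continuousOn_primitive (a := 0) (b := 1) (μ := volume) (f := g)
    (by rwa [integrableOn_Icc_iff_integrableOn_Ioc])
  exact continuousOn_iff_continuous_domRestrict.1 this

/-- solution of the model equation -/
noncomputable def L14 (k : ℝ) (hk : 0 < k) (h : ℝ → ℝ) (hh : IntegrableOn h (Ioc 0 1)) :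
    C(Icc (0:ℝ) 1, ℝ) := ⟨fun t => ∫ s in Ioc 0 t.1, G14 k h s, contPrim14 _ (G14_int k hk h hh)⟩

lemma compact14 (Φ : C(Icc (0:ℝ) 1, ℝ)) : IsCompact {x : C(Icc (0:ℝ) 1, ℝ) |
    x ⟨0, by simp⟩ = 0 ∧ ∀ s t, |x t - x s| ≤ |Φ t - Φ s|} := by
  apply ArzelaAscoli.isCompact_of_equicontinuous
  · have hK : IsCompact (Set.pi univ (fun t : Icc (0:ℝ) 1 =>
        Icc (-|Φ t - Φ ⟨0, by simp⟩|) (|Φ t - Φ ⟨0, by simp⟩|))) :=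
      isCompact_univ_pi (fun t => isCompact_Icc)
    refine hK.of_isClosed_subset (s := _) (t := _) ?_ ?_
    · have : (ContinuousMap.toFun '' {x : C(Icc (0:ℝ) 1, ℝ) |
          x ⟨0, by simp⟩ = 0 ∧ ∀ s t, |x t - x s| ≤ |Φ t - Φ s|}) =
          {f : Icc (0:ℝ) 1 → ℝ | f ⟨0, by simp⟩ = 0} ∩ ⋂ s, ⋂ t, {f | |f t - f s| ≤ |Φ t - Φ s|} := by
        ext f
        simp only [mem_image, mem_ofPred_eq, mem_inter_iff, mem_iInter]
        constructor
        · rintro ⟨x, hx, rfl⟩; exact hx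
        · rintro ⟨h0, hf⟩
          refine ⟨⟨f, ?_⟩, ⟨h0, hf⟩, rfl⟩
          rw [continuous_iff_continuousAt]
          intro s
          rw [ContinuousAt, tendsto_iff_norm_sub_tendsto_zero]
          have h1 : Tendsto (fun t => |Φ t - Φ s|) (𝓝 s) (𝓝 0) := by
            have : Continuous (fun t => |Φ t - Φ s|) := by fun_prop
            simpa using this.tendsto s
          exact squeeze_zero (fun t => norm_nonneg _) (fun t => hf s t) h1
      rw [this]
      refine IsClosed.inter (isClosed_eq (continuous_apply _) continuous_const) ?_
      refine isClosed_iInter fun s => isClosed_iInter fun t => isClosed_le ?_ continuous_const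
      exact ((continuous_apply t).sub (continuous_apply s)).abs
    · rintro f ⟨x, ⟨h0, hx⟩, rfl⟩ t -
      have := hx ⟨0, by simp⟩ t
      rw [h0, sub_zero] at this
      exact abs_le.1 this
  · intro s
    refine Metric.equicontinuousAt_of_continuity_modulus (fun t => |Φ t - Φ s|) ?_ _ ?_
    · have : Continuous (fun t => |Φ t - Φ s|) := by fun_prop
      simpa using this.tendsto s
    · refine Eventually.of_forall fun t x => ?_
      rw [Real.dist_eq]
      exact (x.2.2 t s).trans (abs_sub_comm _ _).le

lemma L14_sol (k : ℝ) (hk : 0 < k) (h : ℝ → ℝ) (hh : IntegrableOn h (Ioc 0 1)) :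
    (∀ t ∈ Icc (0:ℝ) 1, Set.IccExtend (by norm_num : (0:ℝ) ≤ 1) (L14 k hk h hh) t
      = ∫ s in Ioc (0:ℝ) t, G14 k h s) ∧
    ∀ᵐ t ∂(volume.restrict (Ioc (0:ℝ) 1)), G14 k h t =
      -(k / t) * Set.IccExtend (by norm_num : (0:ℝ) ≤ 1) (L14 k hk h hh) t + h t := by
  have h1 : ∀ t ∈ Icc (0:ℝ) 1, Set.IccExtend (by norm_num : (0:ℝ) ≤ 1) (L14 k hk h hh) t
      = ∫ s in Ioc (0:ℝ) t, G14 k h s := by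
    intro t ht
    rw [IccExtend_of_mem _ _ ht]
    rfl
  refine ⟨h1, ?_⟩
  filter_upwards [ae_restrict_mem measurableSet_Ioc] with t ht
  rw [h1 t ⟨ht.1.le, ht.2⟩, G14_eq k hk h hh t ht.1 ht.2]
  ring

lemma PosOp14.abs_le {T} (hT : PosOp14 T) (x : C(Icc (0:ℝ) 1, ℝ)) (hx : ‖x‖ ≤ 1) :
    ∀ᵐ t ∂(volume.restrict (Ioc (0:ℝ) 1)), |T x t| ≤ T 1 t := by
  have hx' : ∀ t, |x t| ≤ 1 := fun t => (x.norm_coe_le_norm t).trans hx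
  filter_upwards [hT.le_of x 1 (fun t => (_root_.abs_le.1 (hx' t)).2),
    hT.ge_of x 1 (fun t => (_root_.abs_le.1 (hx' t)).1)] with t a b
  rw [_root_.abs_le]
  constructor <;> linarith

/-- the integral operator -/
noncomputable def K14 (k : ℝ) (hk : 0 < k) {Tp Tm} (hp : PosOp14 Tp) (hm : PosOp14 Tm) :
    C(Icc (0:ℝ) 1, ℝ) →ₗ[ℝ] C(Icc (0:ℝ) 1, ℝ) where
  toFun x := L14 k hk (Tp x - Tm x) ((hp.int x).sub (hm.int x))
  map_add' x y := by
    ext t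
    simp only [L14, ContinuousMap.coe_mk, ContinuousMap.add_apply]
    have sub : Ioc 0 t.1 ⊆ Ioc 0 1 := Ioc_subset_Ioc_right t.2.2
    have ix := (hp.int x).sub (hm.int x)
    have iy := (hp.int y).sub (hm.int y)
    rw [← integral_add ((G14_int k hk _ ix).mono_set sub) ((G14_int k hk _ iy).mono_set sub)]
    refine setIntegral_congr_fun measurableSet_Ioc ?_
    intro s hs
    simp only
    rw [← G14_add k hk _ _ ix iy s (hs.2.trans t.2.2), hp.lin.map_add, hm.lin.map_add]
    congr 1
    abel
  map_smul' c x := by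
    ext t
    simp only [L14, ContinuousMap.coe_mk, ContinuousMap.smul_apply, RingHom.id_apply, smul_eq_mul]
    rw [← integral_const_mul]
    refine setIntegral_congr_fun measurableSet_Ioc ?_
    intro s hs
    simp only
    rw [← G14_smul, hp.lin.map_smul, hm.lin.map_smul, smul_sub]

lemma K14_compact (k : ℝ) (hk : 0 < k) {Tp Tm} (hp : PosOp14 Tp) (hm : PosOp14 Tm) :
    IsCompactOperator (K14 k hk hp hm) := by
  rw [isCompactOperator_iff_image_closedBall_subset_compact (K14 k hk hp hm) one_pos]
  set φ : ℝ → ℝ := fun s => Tp 1 s + Tm 1 s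
  have hφ : IntegrableOn φ (Ioc 0 1) := (hp.int 1).add (hm.int 1)
  have hH := H14_int k hk φ hφ
  refine ⟨_, compact14 ⟨fun t => ∫ s in Ioc 0 t.1, H14 k φ s, contPrim14 _ hH⟩, ?_⟩
  rintro _ ⟨x, hx, rfl⟩
  have hx1 : ‖x‖ ≤ 1 := by simpa using hx
  have hi := (hp.int x).sub (hm.int x)
  have hG := G14_int k hk _ hi
  have hle : ∀ᵐ s ∂(volume.restrict (Ioc (0:ℝ) 1)), |G14 k (Tp x - Tm x) s| ≤ H14 k φ s := by
    refine G14_le k hk _ φ hφ ?_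
    filter_upwards [hp.abs_le x hx1, hm.abs_le x hx1] with s a b
    exact (abs_sub _ _).trans (add_le_add a b)
  have key : ∀ s t : Icc (0:ℝ) 1, s ≤ t → |(∫ r in Ioc 0 t.1, G14 k (Tp x - Tm x) r)
      - ∫ r in Ioc 0 s.1, G14 k (Tp x - Tm x) r| ≤
      |(∫ r in Ioc 0 t.1, H14 k φ r) - ∫ r in Ioc 0 s.1, H14 k φ r| := by
    intro s t hst
    rw [diff14 _ hG s t s.2.1 hst t.2.2, diff14 _ hH s t s.2.1 hst t.2.2]
    have sub : Ioc s.1 t.1 ⊆ Ioc 0 1 := Ioc_subset_Ioc s.2.1 t.2.2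
    refine le_trans ?_ (le_abs_self _)
    rw [← Real.norm_eq_abs]
    exact norm_integral_le_of_norm_le (hH.mono_set sub)
      (ae_restrict_of_ae_restrict_of_subset sub hle)
  refine ⟨?_, ?_⟩
  · simp [K14, L14]
  · intro s t
    rcases le_total s t with hst | hst
    · exact key s t hst
    · rw [abs_sub_comm, abs_sub_comm (ContinuousMap.mk _ _ t)]
      exact key t s hst

lemma exist14 {k : ℝ} (hk : 0 < k) {Tp Tm} (hp : PosOp14 Tp) (hm : PosOp14 Tm)
    (hu : ∀ x, Sol14 k Tp Tm x → x = 0) (y : C(Icc (0:ℝ) 1, ℝ)) :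
    ∃ x, x = K14 k hk hp hm x + y := by
  have hc := K14_compact k hk hp hm
  set K := ContinuousLinearMap.mkOfIsCompactOperator hc with hK
  have hc' : IsCompactOperator K := hc
  rcases hc'.hasEigenvalue_or_mem_resolventSet (one_ne_zero (α := ℝ)) with h | h
  · exfalso
    obtain ⟨x, hx⟩ := h.exists_hasEigenvector
    have hx0 : K x = x := by simpa using hx.apply_eq_smul
    have hx1 : K14 k hk hp hm x = x := hx0
    refine hx.2 (hu x ?_)
    have hi := (hp.int x).sub (hm.int x)
    obtain ⟨s1, s2⟩ := L14_sol k hk _ hi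
    have e : L14 k hk _ hi = x := hx1
    rw [e] at s1 s2
    exact ⟨_, G14_int k hk _ hi, s1, s2⟩
  · rw [spectrum.mem_resolventSet_iff, ContinuousLinearMap.isUnit_iff_bijective] at h
    obtain ⟨x, hx⟩ := h.2 y
    refine ⟨x, ?_⟩
    have hx0 : x - K x = y := by simpa using hx
    have : x - K14 k hk hp hm x = y := hx0
    rw [← this]; abel

/-- Sufficiency half of Theorem 1: if `𝒯⁺ ≤ 1` and `𝒯⁻ ≤ 2√(1-𝒯⁺)`, then for
`k > 0` and every regular operator `T = T⁺ - T⁻` with `‖T⁺‖_{C→L¹} = 𝒯⁺`,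
`‖T⁻‖_{C→L¹} = 𝒯⁻`, the Cauchy problem `x' = -(k/t)x + Tx + f`, `x 0 = 0`, is
uniquely solvable in `D₊` for every `f ∈ L¹(0,1)`. -/
theorem stmt_14 (𝒯p 𝒯m : ℝ) (h𝒯p0 : 0 ≤ 𝒯p) (h𝒯m0 : 0 ≤ 𝒯m)
    (h1 : 𝒯p ≤ 1) (h2 : 𝒯m ≤ 2 * Real.sqrt (1 - 𝒯p))
    (k : ℝ) (hk : 0 < k)
    (Tp Tm : C(Icc (0:ℝ) 1, ℝ) → ℝ → ℝ)
    (hTplin : IsLinearMap ℝ Tp) (hTmlin : IsLinearMap ℝ Tm)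
    (hTpint : ∀ u, IntegrableOn (Tp u) (Ioc 0 1))
    (hTmint : ∀ u, IntegrableOn (Tm u) (Ioc 0 1))
    (hTppos : ∀ u : C(Icc (0:ℝ) 1, ℝ), (∀ t, 0 ≤ u t) →
      ∀ᵐ t ∂(volume.restrict (Ioc (0:ℝ) 1)), 0 ≤ Tp u t)
    (hTmpos : ∀ u : C(Icc (0:ℝ) 1, ℝ), (∀ t, 0 ≤ u t) →
      ∀ᵐ t ∂(volume.restrict (Ioc (0:ℝ) 1)), 0 ≤ Tm u t)
    (hTpnorm : (∫ t in Ioc (0:ℝ) 1, Tp 1 t) = 𝒯p)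
    (hTmnorm : (∫ t in Ioc (0:ℝ) 1, Tm 1 t) = 𝒯m)
    (f : ℝ → ℝ) (hf : IntegrableOn f (Ioc 0 1)) :
    ∃! x : C(Icc (0:ℝ) 1, ℝ),
      (Set.IccExtend (by norm_num : (0:ℝ) ≤ 1) x) 0 = 0 ∧
      IntegrableOn
        (fun t => |Set.IccExtend (by norm_num : (0:ℝ) ≤ 1) x t| / t) (Ioc 0 1) ∧
      ∃ g : ℝ → ℝ, IntegrableOn g (Ioc 0 1) ∧
        (∀ t ∈ Icc (0:ℝ) 1,
          Set.IccExtend (by norm_num : (0:ℝ) ≤ 1) x t = ∫ s in Ioc (0:ℝ) t, g s) ∧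
        (∀ᵐ t ∂(volume.restrict (Ioc (0:ℝ) 1)),
          g t = -(k / t) * Set.IccExtend (by norm_num : (0:ℝ) ≤ 1) x t
            + (Tp x t - Tm x t) + f t) := by
  have hp : PosOp14 Tp := ⟨hTplin, hTpint, hTppos⟩
  have hm : PosOp14 Tm := ⟨hTmlin, hTmint, hTmpos⟩
  have hu : ∀ x, Sol14 k Tp Tm x → x = 0 := fun x hx =>
    uniq14 hk hp hm 𝒯p 𝒯m h1 h2 hTpnorm hTmnorm hx
  obtain ⟨x, hx⟩ := exist14 hk hp hm hu (L14 k hk f hf)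
  have hi := (hp.int x).sub (hm.int x)
  have hi2 : IntegrableOn ((Tp x - Tm x) + f) (Ioc 0 1) := hi.add hf
  have hxL : x = L14 k hk _ hi2 := by
    ext t
    have sub : Ioc 0 t.1 ⊆ Ioc 0 1 := Ioc_subset_Ioc_right t.2.2
    have e : x t = K14 k hk hp hm x t + L14 k hk f hf t := by
      conv_lhs => rw [hx]
      rfl
    rw [e]
    simp only [K14, L14, ContinuousMap.coe_mk, LinearMap.coe_mk, AddHom.coe_mk]
    rw [← integral_add ((G14_int k hk _ hi).mono_set sub) ((G14_int k hk _ hf).mono_set sub)]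
    refine setIntegral_congr_fun measurableSet_Ioc ?_
    intro s hs
    simp only
    rw [← G14_add k hk _ _ hi hf s (hs.2.trans t.2.2)]
  obtain ⟨s1, s2⟩ := L14_sol k hk _ hi2
  rw [← hxL] at s1 s2
  have hG := G14_int k hk _ hi2
  refine ⟨x, ⟨?_, ?_, _, hG, s1, ?_⟩, ?_⟩
  · rw [s1 0 (by simp)]; simp
  · have : IntegrableOn (fun t => k⁻¹ * |((Tp x - Tm x) + f) t
        - G14 k ((Tp x - Tm x) + f) t|) (Ioc 0 1) := ((hi2.sub hG).abs).const_mul _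
    refine this.congr ?_
    filter_upwards [s2, ae_restrict_mem measurableSet_Ioc] with t ht ht1
    rw [ht]
    have : ∀ a b : ℝ, a - (-(k / t) * b + a) = k / t * b := by intros; ring
    rw [this, abs_mul, abs_of_pos (div_pos hk ht1.1)]
    field_simp
  · filter_upwards [s2] with t ht
    rw [ht, add_assoc]
    rfl
  · rintro y ⟨-, -, g, g1, g2, g3⟩
    refine sub_eq_zero.1 (hu (y - x) ⟨g - G14 k ((Tp x - Tm x) + f), g1.sub hG, ?_, ?_⟩)
    · intro t ht
      have sub : Ioc 0 t ⊆ Ioc 0 1 := Ioc_subset_Ioc_right ht.2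
      rw [IccExtend_sub14, g2 t ht, s1 t ht,
        ← integral_sub (g1.mono_set sub) (hG.mono_set sub)]
      rfl
    · filter_upwards [g3, s2] with t a b
      rw [IccExtend_sub14, hp.lin.map_sub, hm.lin.map_sub]
      simp only [Pi.sub_apply, Pi.add_apply] at a b ⊢
      rw [a, b]
      ring
end

section
/- Let T⁺, T⁻ ≥ 0 with T⁻ ≤ 1 and T⁺ ≤ 2√(1 - T⁻), and let k < 0. Then for every regular operator T = T⁺op - T⁻op with positive parts of norms ‖T⁺op‖_{C→L¹} = T⁺, ‖T⁻op‖_{C→L¹} = T⁻, the boundary value problem x' = -(k/t)x + Tx + f, x(1) = c, is uniquely solvable in the space D₋ for every f ∈ L¹(0,1) and c ∈ ℝ. -/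
open MeasureTheory Set Filter Topology

/-- The weighted tail integral. -/
noncomputable def tailInt (m : ℝ) (h : ℝ → ℝ) (t : ℝ) : ℝ := ∫ r in Ioc t 1, (t / r) ^ m * h r

lemma ratio_bounds {m a r : ℝ} (hm : 0 < m) (ha : 0 ≤ a) (har : a ≤ r) :
    0 ≤ (a / r) ^ m ∧ (a / r) ^ m ≤ 1 := by
  have hr : 0 ≤ r := ha.trans har
  have h0 : 0 ≤ a / r := div_nonneg ha hr
  exact ⟨Real.rpow_nonneg h0 _, Real.rpow_le_one h0 (div_le_one_of_le₀ har hr) hm.le⟩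

lemma integrable_ratio {m a b : ℝ} (hm : 0 < m) (ha : 0 ≤ a) {h : ℝ → ℝ}
    (hh : IntegrableOn h (Ioc a b)) : IntegrableOn (fun r => (a / r) ^ m * h r) (Ioc a b) := by
  refine Integrable.bdd_mul (c := 1) hh ?_ ?_
  · exact Measurable.aestronglyMeasurable (by fun_prop)
  · filter_upwards [ae_restrict_mem measurableSet_Ioc] with r hr
    have := ratio_bounds hm ha hr.1.le
    rw [Real.norm_eq_abs, abs_of_nonneg this.1]
    exact this.2

lemma ratio_le {m a b : ℝ} (hm : 0 < m) (ha : 0 ≤ a) {h w : ℝ → ℝ}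
    (hh : IntegrableOn h (Ioc a b)) (hw : IntegrableOn w (Ioc a b))
    (hle : ∀ᵐ r ∂(volume.restrict (Ioc a b)), h r ≤ w r)
    (hw0 : ∀ᵐ r ∂(volume.restrict (Ioc a b)), 0 ≤ w r) :
    ∫ r in Ioc a b, (a / r) ^ m * h r ≤ ∫ r in Ioc a b, w r := by
  refine integral_mono_ae (integrable_ratio hm ha hh) hw ?_
  filter_upwards [ae_restrict_mem measurableSet_Ioc, hle, hw0] with r hr h1 h2
  have := ratio_bounds hm ha hr.1.le
  calc (a / r) ^ m * h r ≤ (a / r) ^ m * w r := mul_le_mul_of_nonneg_left h1 this.1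
    _ ≤ 1 * w r := mul_le_mul_of_nonneg_right this.2 h2
    _ = w r := one_mul _

lemma ratio_lt_one {m a : ℝ} (hm : 0 < m) (ha : 0 ≤ a) {q : ℝ → ℝ}
    (hq : IntegrableOn q (Ioc a 1)) 
    (hq0 : ∀ᵐ r ∂(volume.restrict (Ioc a 1)), 0 ≤ q r)
    (hq1 : ∫ r in Ioc a 1, q r ≤ 1) :
    ∫ r in Ioc a 1, (a / r) ^ m * q r < 1 := by
  by_contra! hcon
  have hi := integrable_ratio (b := 1) hm ha hq
  have hnn : 0 ≤ᵐ[volume.restrict (Ioc a 1)] fun r => q r - (a / r) ^ m * q r := by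
    filter_upwards [ae_restrict_mem measurableSet_Ioc, hq0] with r hr h2
    have := ratio_bounds hm ha hr.1.le
    have h3 := mul_le_mul_of_nonneg_right this.2 h2
    simp only [Pi.zero_apply]
    linarith
  have hz : ∫ r in Ioc a 1, (q r - (a / r) ^ m * q r) = 0 := by
    apply le_antisymm
    · rw [integral_sub hq hi]; linarith
    · exact integral_nonneg_of_ae hnn
  rw [integral_eq_zero_iff_of_nonneg_ae hnn (hq.sub hi)] at hz
  have hq00 : q =ᵐ[volume.restrict (Ioc a 1)] 0 := by
    filter_upwards [ae_restrict_mem measurableSet_Ioc, hz] with r hr h2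
    have hr0 : 0 < r := ha.trans_lt hr.1
    have hlt : (a / r) ^ m < 1 :=
      Real.rpow_lt_one (div_nonneg ha hr0.le) ((div_lt_one hr0).2 hr.1) hm
    simp only [Pi.zero_apply] at h2 ⊢
    have h3 : (1 - (a / r) ^ m) * q r = 0 := by linarith
    rcases mul_eq_zero.1 h3 with h | h
    · linarith
    · exact h
  have : ∫ r in Ioc a 1, (a / r) ^ m * q r = 0 := by
    rw [integral_eq_zero_of_ae]
    filter_upwards [hq00] with r hr
    simp [hr]
  linarith

lemma tailInt_split {m a b : ℝ} (hm : 0 < m) (ha : 0 ≤ a) (hab : a < b) (hb : b ≤ 1) {h : ℝ → ℝ}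
    (hh : IntegrableOn h (Ioc 0 1)) :
    tailInt m h a = (∫ r in Ioc a b, (a / r) ^ m * h r) + (a / b) ^ m * tailInt m h b := by
  have hb0 : 0 < b := ha.trans_lt hab
  have hi : IntegrableOn (fun r => (a / r) ^ m * h r) (Ioc a 1) :=
    integrable_ratio hm ha (hh.mono_set (Ioc_subset_Ioc_left ha))
  unfold tailInt
  rw [← Ioc_union_Ioc_eq_Ioc hab.le hb, setIntegral_union (Ioc_disjoint_Ioc_of_le le_rfl)
    measurableSet_Ioc (hi.mono_set (Ioc_subset_Ioc_right hb))
    (hi.mono_set (Ioc_subset_Ioc_left hab.le)), ← integral_const_mul]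
  congr 1
  refine setIntegral_congr_fun measurableSet_Ioc fun r hr => ?_
  have hr0 : 0 < r := hb0.trans hr.1
  rw [← mul_assoc, ← Real.mul_rpow (by positivity) (by positivity)]
  congr 2
  field_simp

lemma tailInt_zero {m : ℝ} (hm : 0 < m) (h : ℝ → ℝ) : tailInt m h 0 = 0 := by
  simp [tailInt, Real.zero_rpow hm.ne']

lemma tailInt_one {m : ℝ} (h : ℝ → ℝ) : tailInt m h 1 = 0 := by
  simp [tailInt]

lemma tailInt_neg {m : ℝ} (h : ℝ → ℝ) (t : ℝ) : tailInt m (fun r => -h r) t = - tailInt m h t := by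
  simp [tailInt, integral_neg]

lemma tailInt_add {m t : ℝ} (hm : 0 < m) (ht : 0 ≤ t) {h g : ℝ → ℝ}
    (hh : IntegrableOn h (Ioc 0 1)) (hg : IntegrableOn g (Ioc 0 1)) :
    tailInt m (fun r => h r + g r) t = tailInt m h t + tailInt m g t := by
  simp only [tailInt, mul_add]
  exact integral_add (integrable_ratio hm ht (hh.mono_set (Ioc_subset_Ioc_left ht)))
    (integrable_ratio hm ht (hg.mono_set (Ioc_subset_Ioc_left ht)))

lemma tailInt_smul {m t c : ℝ} {h : ℝ → ℝ} :
    tailInt m (fun r => c * h r) t = c * tailInt m h t := by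
  simp only [tailInt, ← integral_const_mul]
  congr 1; ext r; ring

lemma tailInt_mono {m t : ℝ} (hm : 0 < m) (ht : 0 ≤ t) {h g : ℝ → ℝ}
    (hh : IntegrableOn h (Ioc 0 1)) (hg : IntegrableOn g (Ioc 0 1))
    (hle : ∀ᵐ r ∂(volume.restrict (Ioc (0:ℝ) 1)), h r ≤ g r) :
    tailInt m h t ≤ tailInt m g t := by
  refine integral_mono_ae (integrable_ratio hm ht (hh.mono_set (Ioc_subset_Ioc_left ht)))
    (integrable_ratio hm ht (hg.mono_set (Ioc_subset_Ioc_left ht))) ?_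
  filter_upwards [ae_restrict_mem measurableSet_Ioc,
    ae_restrict_of_ae_restrict_of_subset (Ioc_subset_Ioc_left ht) hle] with r hr h1
  exact mul_le_mul_of_nonneg_left h1 (ratio_bounds hm ht hr.1.le).1

/-- the kernel used for Fubini -/
noncomputable def kern (m : ℝ) (h : ℝ → ℝ) (s r : ℝ) : ℝ :=
  (Iic r).indicator (fun s => s ^ (m - 1)) s * (r ^ (-m) * h r)

lemma kern_inner {m t r : ℝ} (hm : 0 < m) (ht : 0 ≤ t) (hr : 0 < r) :
    IntegrableOn ((Iic r).indicator (fun s : ℝ => s ^ (m - 1))) (Ioc 0 t) ∧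
    ∫ s in Ioc 0 t, (Iic r).indicator (fun s : ℝ => s ^ (m - 1)) s = (min t r) ^ m / m := by
  have hpow : IntegrableOn (fun s : ℝ => s ^ (m - 1)) (Ioc 0 t) := by
    rw [← intervalIntegrable_iff_integrableOn_Ioc_of_le ht]
    exact intervalIntegral.intervalIntegrable_rpow' (by linarith)
  refine ⟨hpow.indicator measurableSet_Iic, ?_⟩
  rw [setIntegral_indicator measurableSet_Iic, Ioc_inter_Iic,
    ← intervalIntegral.integral_of_le (le_min ht hr.le), integral_rpow (Or.inl (by linarith))]
  simp [Real.zero_rpow hm.ne']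

lemma kern_integrable {m t : ℝ} (hm : 0 < m) (ht : 0 ≤ t) {h : ℝ → ℝ}
    (hh : IntegrableOn h (Ioc 0 1)) :
    Integrable (Function.uncurry (kern m h))
      ((volume.restrict (Ioc 0 t)).prod (volume.restrict (Ioc 0 1))) := by
  have hmeas : AEStronglyMeasurable (Function.uncurry (kern m h))
      ((volume.restrict (Ioc 0 t)).prod (volume.restrict (Ioc 0 1))) := by
    have h1 : AEStronglyMeasurable (fun z : ℝ × ℝ => h z.2)
      ((volume.restrict (Ioc 0 t)).prod (volume.restrict (Ioc 0 1))) :=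
      hh.aestronglyMeasurable.comp_snd
    have h2 : Measurable (fun z : ℝ × ℝ => 
        ({z : ℝ × ℝ | z.1 ≤ z.2}.indicator (fun z => z.1 ^ (m - 1)) z) * z.2 ^ (-m)) := by
      refine Measurable.mul (Measurable.indicator (by fun_prop) ?_) (by fun_prop)
      exact measurableSet_le measurable_fst measurable_snd
    refine (h2.aestronglyMeasurable.mul h1).congr (Eventually.of_forall ?_)
    rintro ⟨s, r⟩
    simp only [Function.uncurry, kern, indicator, mem_ofPred_eq, mem_Iic, Pi.mul_apply]
    ring
  rw [integrable_prod_iff' hmeas]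
  constructor
  · filter_upwards [ae_restrict_mem measurableSet_Ioc] with r hr
    exact (kern_inner hm ht hr.1).1.mul_const (r ^ (-m) * h r)
  · have : ∀ᵐ r ∂(volume.restrict (Ioc (0:ℝ) 1)), (min t r / r) ^ m * (|h r| / m) = 
      ∫ s in Ioc 0 t, ‖Function.uncurry (kern m h) (s, r)‖ := by
      filter_upwards [ae_restrict_mem measurableSet_Ioc] with r hr
      have e : ∀ s ∈ Ioc (0:ℝ) t, ‖Function.uncurry (kern m h) (s, r)‖ = 
          (Iic r).indicator (fun s : ℝ => s ^ (m - 1)) s * (r ^ (-m) * |h r|) := by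
        intro s hs
        simp only [Function.uncurry, kern, norm_mul, Real.norm_eq_abs]
        rw [abs_of_nonneg (Real.rpow_nonneg hr.1.le _), abs_of_nonneg]
        exact indicator_apply_nonneg fun _ => Real.rpow_nonneg hs.1.le _
      rw [setIntegral_congr_fun measurableSet_Ioc e, integral_mul_const,
        (kern_inner hm ht hr.1).2, Real.div_rpow (le_min ht hr.1.le) hr.1.le,
        Real.rpow_neg hr.1.le]
      ring
    refine Integrable.congr ?_ this
    refine Integrable.bdd_mul (c := 1) (hh.abs.div_const m) ?_ ?_
    · exact Measurable.aestronglyMeasurable (by fun_prop)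
    · filter_upwards [ae_restrict_mem measurableSet_Ioc] with r hr
      have := ratio_bounds hm (le_min ht hr.1.le) (min_le_right t r)
      rw [Real.norm_eq_abs, abs_of_nonneg this.1]
      exact this.2

lemma kern_outer {m s : ℝ} (h : ℝ → ℝ) (hs : s ∈ Ioc (0:ℝ) 1) :
    ∫ r in Ioc 0 1, kern m h s r = tailInt m h s / s := by
  unfold tailInt
  have : ∀ r ∈ Ioc (0:ℝ) 1, kern m h s r = 
      (Ici s).indicator (fun r => (s / r) ^ m * h r / s) r := by
    intro r hr
    simp only [kern, indicator, mem_Iic, mem_Ici]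
    split_ifs
    · rw [Real.div_rpow hs.1.le hr.1.le, Real.rpow_neg hr.1.le, Real.rpow_sub_one hs.1.ne']
      ring
    · simp
  rw [setIntegral_congr_fun measurableSet_Ioc this, setIntegral_indicator measurableSet_Ici,
    ← integral_div, ← integral_Icc_eq_integral_Ioc]
  congr 2
  ext r
  simp only [mem_inter_iff, mem_Ioc, mem_Ici, mem_Icc]
  constructor
  · rintro ⟨⟨_, h⟩, h'⟩; exact ⟨h', h⟩
  · rintro ⟨h, h'⟩; exact ⟨⟨hs.1.trans_le h, h'⟩, h⟩

lemma tailInt_div_integrable {m : ℝ} (hm : 0 < m) {h : ℝ → ℝ}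
    (hh : IntegrableOn h (Ioc 0 1)) : IntegrableOn (fun s => tailInt m h s / s) (Ioc 0 1) := by
  have := (kern_integrable hm zero_le_one hh).integral_prod_left
  refine Integrable.congr this ?_
  filter_upwards [ae_restrict_mem measurableSet_Ioc] with s hs
  exact kern_outer h hs

lemma tailInt_div_integral {m t : ℝ} (hm : 0 < m) (ht : t ∈ Icc (0:ℝ) 1) {h : ℝ → ℝ}
    (hh : IntegrableOn h (Ioc 0 1)) : 
    m * ∫ s in Ioc 0 t, tailInt m h s / s = (∫ r in Ioc 0 t, h r) + tailInt m h t := by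
  have h1 : ∫ s in Ioc 0 t, tailInt m h s / s = ∫ s in Ioc 0 t, ∫ r in Ioc 0 1, kern m h s r := by
    refine setIntegral_congr_fun measurableSet_Ioc fun s hs => ?_
    exact (kern_outer h ⟨hs.1, hs.2.trans ht.2⟩).symm
  rw [h1, integral_integral_swap (kern_integrable hm ht.1 hh), ← integral_const_mul]
  have h2 : ∀ r ∈ Ioc (0:ℝ) 1, m * ∫ s in Ioc 0 t, kern m h s r = (min t r / r) ^ m * h r := by
    intro r hr
    simp only [kern]
    rw [integral_mul_const, (kern_inner hm ht.1 hr.1).2,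
      Real.div_rpow (le_min ht.1 hr.1.le) hr.1.le, Real.rpow_neg hr.1.le]
    field_simp
  rw [setIntegral_congr_fun measurableSet_Ioc h2]
  have e1 : EqOn (fun r => (min t r / r) ^ m * h r) h (Ioc 0 t) := by
    intro r hr
    simp [min_eq_right hr.2, div_self hr.1.ne']
  have e2 : EqOn (fun r => (min t r / r) ^ m * h r) (fun r => (t / r) ^ m * h r) (Ioc t 1) := by
    intro r hr
    simp [min_eq_left hr.1.le]
  rw [← Ioc_union_Ioc_eq_Ioc ht.1 ht.2, setIntegral_union (Ioc_disjoint_Ioc_of_le le_rfl)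
    measurableSet_Ioc, setIntegral_congr_fun measurableSet_Ioc e1,
    setIntegral_congr_fun measurableSet_Ioc e2]
  · rfl
  · exact (hh.mono_set (Ioc_subset_Ioc_right ht.2)).congr_fun e1.symm measurableSet_Ioc
  · exact (integrable_ratio hm ht.1 (hh.mono_set (Ioc_subset_Ioc_left ht.1))).congr_fun e2.symm
      measurableSet_Ioc

lemma arith_key {M N a b c d P Q : ℝ} (hM : 0 < M) (hN : 0 < N) (ha : 0 ≤ a) (hb : 0 ≤ b)
    (hc : 0 ≤ c) (hd : 0 ≤ d) (hP : a + c ≤ P) (hQ : b + d ≤ Q) (hQ1 : Q ≤ 1)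
    (hPQ : P ≤ 2 * Real.sqrt (1 - Q)) (h1 : M < N * a + M * b) (h2 : N ≤ M * c + N * d) :
    False := by
  have hP0 : 0 ≤ P := by linarith
  have hs := Real.sq_sqrt (show 0 ≤ 1 - Q by linarith)
  have hP2 : P ^ 2 ≤ 4 * (1 - Q) := by
    have := pow_le_pow_left₀ hP0 hPQ 2
    nlinarith
  have hac2 : (a + c) ^ 2 ≤ P ^ 2 := pow_le_pow_left₀ (by linarith) hP 2
  have hac : a * c ≤ 1 - b - d := by nlinarith [sq_nonneg (a - c)]
  rcases hc.eq_or_lt with hc0 | hc0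
  · subst hc0
    have hd1 : 1 ≤ d := by
      by_contra! h
      nlinarith
    have hb0 : b = 0 := by linarith
    have hQ' : Q = 1 := by linarith
    subst hQ'
    have : a = 0 := by nlinarith
    subst this hb0
    linarith
  · have e1 : M * (1 - b) < N * a := by linarith
    have e2 : N * (1 - d) ≤ M * c := by linarith
    have e3 : (M * (1 - b)) * (N * (1 - d)) ≤ (M * (1 - b)) * (M * c) :=
      mul_le_mul_of_nonneg_left e2 (mul_nonneg hM.le (by linarith))
    have e4 : (M * (1 - b)) * (M * c) < (N * a) * (M * c) :=
      mul_lt_mul_of_pos_right e1 (by positivity)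
    have e5 : (M * N) * ((1 - b) * (1 - d)) < (M * N) * (a * c) := by nlinarith
    have e6 := lt_of_mul_lt_mul_left e5 (by positivity)
    nlinarith [mul_nonneg hb hd]

lemma key_lt {m P Q M N t1 t2 : ℝ} (hm : 0 < m) (hQ1 : Q ≤ 1) (hPQ : P ≤ 2 * Real.sqrt (1 - Q))
    {p q h : ℝ → ℝ} (hp : IntegrableOn p (Ioc 0 1)) (hq : IntegrableOn q (Ioc 0 1))
    (hh : IntegrableOn h (Ioc 0 1))
    (hp0 : ∀ᵐ t ∂(volume.restrict (Ioc (0:ℝ) 1)), 0 ≤ p t)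
    (hq0 : ∀ᵐ t ∂(volume.restrict (Ioc (0:ℝ) 1)), 0 ≤ q t)
    (hpP : ∫ t in Ioc (0:ℝ) 1, p t = P) (hqQ : ∫ t in Ioc (0:ℝ) 1, q t = Q)
    (hM : 0 < M) (hN : 0 < N)
    (hup : ∀ᵐ t ∂(volume.restrict (Ioc (0:ℝ) 1)), h t ≤ M * p t + N * q t)
    (hlo : ∀ᵐ t ∂(volume.restrict (Ioc (0:ℝ) 1)), -h t ≤ N * p t + M * q t)
    (ht1 : t1 ∈ Icc (0:ℝ) 1) (ht2 : t2 ∈ Icc (0:ℝ) 1)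
    (e1 : tailInt m h t1 = -M) (e2 : tailInt m h t2 = N) (hlt : t1 < t2) : False := by
  have ht10 : 0 < t1 := by
    rcases ht1.1.eq_or_lt with h0 | h0
    · rw [← h0, tailInt_zero hm] at e1; linarith
    · exact h0
  have s1 : Ioc t1 t2 ⊆ Ioc 0 1 := Ioc_subset_Ioc ht1.1 ht2.2
  have s2 : Ioc t2 1 ⊆ Ioc 0 1 := Ioc_subset_Ioc_left ht2.1
  have sp := tailInt_split hm ht1.1 hlt ht2.2 hh
  rw [e1, e2] at sp
  have q0 : 0 < (t1 / t2) ^ m := Real.rpow_pos_of_pos (div_pos ht10 (ht10.trans hlt)) _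
  have b1 : ∫ r in Ioc t1 t2, (t1 / r) ^ m * (-h r) ≤ ∫ r in Ioc t1 t2, (N * p r + M * q r) := by
    refine ratio_le hm ht1.1 (hh.mono_set s1).neg
      (((hp.mono_set s1).const_mul N).add ((hq.mono_set s1).const_mul M))
      (ae_restrict_of_ae_restrict_of_subset s1 hlo) (ae_restrict_of_ae_restrict_of_subset s1 ?_)
    filter_upwards [hp0, hq0] with t h1 h2
    positivity
  have b2 : tailInt m h t2 ≤ ∫ r in Ioc t2 1, (M * p r + N * q r) := by
    refine ratio_le hm ht2.1 (hh.mono_set s2)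
      (((hp.mono_set s2).const_mul M).add ((hq.mono_set s2).const_mul N))
      (ae_restrict_of_ae_restrict_of_subset s2 hup) (ae_restrict_of_ae_restrict_of_subset s2 ?_)
    filter_upwards [hp0, hq0] with t h1 h2
    positivity
  rw [e2, integral_add ((hp.mono_set s2).const_mul M) ((hq.mono_set s2).const_mul N),
    integral_const_mul, integral_const_mul] at b2
  rw [integral_add ((hp.mono_set s1).const_mul N) ((hq.mono_set s1).const_mul M),
    integral_const_mul, integral_const_mul] at b1
  simp only [mul_neg, integral_neg] at b1
  have tot : ∀ u : ℝ → ℝ, IntegrableOn u (Ioc 0 1) →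
      (∀ᵐ t ∂(volume.restrict (Ioc (0:ℝ) 1)), 0 ≤ u t) →
      (∫ r in Ioc t1 t2, u r) + (∫ r in Ioc t2 1, u r) ≤ ∫ r in Ioc 0 1, u r := by
    intro u hu hu0
    rw [← setIntegral_union (Ioc_disjoint_Ioc_of_le le_rfl) measurableSet_Ioc (hu.mono_set s1)
      (hu.mono_set s2)]
    exact setIntegral_mono_set hu hu0 (LE.le.eventuallyLE (union_subset s1 s2))
  have nn : ∀ (s : Set ℝ) (u : ℝ → ℝ), s ⊆ Ioc 0 1 →
      (∀ᵐ t ∂(volume.restrict (Ioc (0:ℝ) 1)), 0 ≤ u t) → 0 ≤ ∫ r in s, u r := fun s u hs hu =>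
    integral_nonneg_of_ae (ae_restrict_of_ae_restrict_of_subset hs hu)
  refine arith_key hM hN (nn _ p s1 hp0) (nn _ q s1 hq0) (nn _ p s2 hp0) (nn _ q s2 hq0)
    ((tot p hp hp0).trans hpP.le) ((tot q hq hq0).trans hqQ.le) hQ1 hPQ ?_ b2
  have : 0 < (t1 / t2) ^ m * N := by positivity
  linarith

lemma key_one {m Q M t1 : ℝ} (hm : 0 < m) (hQ1 : Q ≤ 1)
    {q h : ℝ → ℝ} (hq : IntegrableOn q (Ioc 0 1))
    (hh : IntegrableOn h (Ioc 0 1))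
    (hq0 : ∀ᵐ t ∂(volume.restrict (Ioc (0:ℝ) 1)), 0 ≤ q t)
    (hqQ : ∫ t in Ioc (0:ℝ) 1, q t = Q)
    (hM : 0 < M)
    (hlo : ∀ᵐ t ∂(volume.restrict (Ioc (0:ℝ) 1)), -h t ≤ M * q t)
    (ht1 : t1 ∈ Icc (0:ℝ) 1)
    (e1 : tailInt m h t1 = -M) : False := by
  have h1 := tailInt_mono hm ht1.1 hh.neg (hq.const_mul M) hlo
  have h2 : tailInt m (-h) t1 = -tailInt m h t1 := tailInt_neg h t1
  rw [h2, e1, tailInt_smul] at h1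
  have s : Ioc t1 1 ⊆ Ioc 0 1 := Ioc_subset_Ioc_left ht1.1
  have h3 : tailInt m q t1 < 1 := by
    refine ratio_lt_one hm ht1.1 (hq.mono_set s) (ae_restrict_of_ae_restrict_of_subset s hq0) ?_
    exact (setIntegral_mono_set hq hq0 (LE.le.eventuallyLE s)).trans (hqQ.le.trans hQ1)
  nlinarith

lemma key {m P Q M N t1 t2 : ℝ} (hm : 0 < m) (hQ1 : Q ≤ 1) (hPQ : P ≤ 2 * Real.sqrt (1 - Q))
    {p q h : ℝ → ℝ} (hp : IntegrableOn p (Ioc 0 1)) (hq : IntegrableOn q (Ioc 0 1))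
    (hh : IntegrableOn h (Ioc 0 1))
    (hp0 : ∀ᵐ t ∂(volume.restrict (Ioc (0:ℝ) 1)), 0 ≤ p t)
    (hq0 : ∀ᵐ t ∂(volume.restrict (Ioc (0:ℝ) 1)), 0 ≤ q t)
    (hpP : ∫ t in Ioc (0:ℝ) 1, p t = P) (hqQ : ∫ t in Ioc (0:ℝ) 1, q t = Q)
    (hM : 0 ≤ M) (hN : 0 ≤ N)
    (hM' : N = 0 → ∀ᵐ t ∂(volume.restrict (Ioc (0:ℝ) 1)), -h t ≤ M * q t)
    (hN' : M = 0 → ∀ᵐ t ∂(volume.restrict (Ioc (0:ℝ) 1)), h t ≤ N * q t)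
    (hup : ∀ᵐ t ∂(volume.restrict (Ioc (0:ℝ) 1)), h t ≤ M * p t + N * q t)
    (hlo : ∀ᵐ t ∂(volume.restrict (Ioc (0:ℝ) 1)), -h t ≤ N * p t + M * q t)
    (ht1 : t1 ∈ Icc (0:ℝ) 1) (ht2 : t2 ∈ Icc (0:ℝ) 1)
    (e1 : tailInt m h t1 = -M) (e2 : tailInt m h t2 = N) : M = 0 ∧ N = 0 := by
  have n1 : tailInt m (-h) t1 = -tailInt m h t1 := tailInt_neg h t1
  have n2 : tailInt m (-h) t2 = -tailInt m h t2 := tailInt_neg h t2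
  rcases hM.eq_or_lt with hM0 | hM0
  · rcases hN.eq_or_lt with hN0 | hN0
    · exact ⟨hM0.symm, hN0.symm⟩
    · exfalso
      refine key_one hm hQ1 hq hh.neg hq0 hqQ hN0 ?_ ht2 (by rw [n2, e2])
      simpa using hN' hM0.symm
  · exfalso
    rcases hN.eq_or_lt with hN0 | hN0
    · exact key_one hm hQ1 hq hh hq0 hqQ hM0 (hM' hN0.symm) ht1 e1
    · rcases lt_trichotomy t1 t2 with hlt | heq | hlt
      · exact key_lt hm hQ1 hPQ hp hq hh hp0 hq0 hpP hqQ hM0 hN0 hup hlo ht1 ht2 e1 e2 hlt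
      · rw [heq, e2] at e1; linarith
      · exact key_lt hm hQ1 hPQ hp hq hh.neg hp0 hq0 hpP hqQ hN0 hM0 hlo (by simpa using hup)
          ht2 ht1 (by rw [n2, e2]) (by rw [n1, e1, neg_neg]) hlt

lemma ode_unique {m : ℝ} {w : ℝ → ℝ} (hw : Continuous w)
    (hi : IntegrableOn (fun s => m / s * w s) (Ioc 0 1))
    (he : ∀ t ∈ Icc (0:ℝ) 1, w t = ∫ s in Ioc 0 t, m / s * w s) (h1 : w 1 = 0) :
    ∀ t ∈ Icc (0:ℝ) 1, w t = 0 := by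
  intro t ht
  rcases ht.1.eq_or_lt with h0 | h0
  · rw [he t ht, ← h0]; simp
  have hd : ∀ s ∈ Ioo (0:ℝ) 1, HasDerivAt w (m / s * w s) s := by
    intro s hs
    have hc : ContinuousOn (fun s => m / s * w s) (Ioo 0 1) := by
      refine ContinuousOn.mul (ContinuousOn.div continuousOn_const continuousOn_id ?_)
        hw.continuousOn
      intro x hx; exact hx.1.ne'
    have := intervalIntegral.integral_hasDerivAt_right (f := fun s => m / s * w s) (a := 0) (b := s)
      ((intervalIntegrable_iff_integrableOn_Ioc_of_le hs.1.le).2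
        (hi.mono_set (Ioc_subset_Ioc_right hs.2.le)))
      (hc.stronglyMeasurableAtFilter isOpen_Ioo s hs)
      (hc.continuousAt (isOpen_Ioo.mem_nhds hs))
    refine this.congr_of_eventuallyEq ?_
    filter_upwards [isOpen_Ioo.mem_nhds hs] with u hu
    rw [he u ⟨hu.1.le, hu.2.le⟩, intervalIntegral.integral_of_le hu.1.le]
  have hconst := constant_of_has_deriv_right_zero (f := fun s => s ^ (-m) * w s) (a := t) (b := 1)
    ?_ ?_ 1 ⟨ht.2, le_rfl⟩
  · simp only [h1, mul_zero] at hconst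
    have hp : t ^ (-m) ≠ 0 := (Real.rpow_pos_of_pos h0 _).ne'
    exact (mul_eq_zero.1 hconst.symm).resolve_left hp
  · refine ContinuousOn.mul ?_ hw.continuousOn
    intro s hs
    exact (Real.continuousAt_rpow_const _ _ (Or.inl (h0.trans_le hs.1).ne')).continuousWithinAt
  · intro s hs
    have hs0 : 0 < s := h0.trans_le hs.1
    have := ((Real.hasDerivAt_rpow_const (x := s) (p := -m) (Or.inl hs0.ne')).mul
      (hd s ⟨hs0, hs.2⟩)).hasDerivWithinAt (s := Ici s)
    convert! this using 1
    rw [Real.rpow_sub_one hs0.ne']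
    field_simp
    ring

lemma tailInt_eq_prim {m : ℝ} (hm : 0 < m) {h : ℝ → ℝ}
    (hh : IntegrableOn h (Ioc 0 1)) :
    IntegrableOn (fun s => m * (tailInt m h s / s) - h s) (Ioc 0 1) ∧
    ∀ t ∈ Icc (0:ℝ) 1, tailInt m h t = ∫ s in Ioc 0 t, (m * (tailInt m h s / s) - h s) := by
  have hi := (tailInt_div_integrable hm hh).const_mul m
  refine ⟨hi.sub hh, fun t ht => ?_⟩
  have s : Ioc 0 t ⊆ Ioc (0:ℝ) 1 := Ioc_subset_Ioc_right ht.2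
  have hi' : IntegrableOn (fun s => m * (tailInt m h s / s)) (Ioc 0 1) := hi
  rw [integral_sub (hi'.mono_set s) (hh.mono_set s), integral_const_mul,
    tailInt_div_integral hm ht hh]
  ring

lemma tailInt_continuousOn {m : ℝ} (hm : 0 < m) {h : ℝ → ℝ}
    (hh : IntegrableOn h (Ioc 0 1)) : ContinuousOn (tailInt m h) (Icc 0 1) := by
  obtain ⟨h1, h2⟩ := tailInt_eq_prim hm hh
  refine ContinuousOn.congr ?_ h2
  exact intervalIntegral.continuousOn_primitive
    ((integrableOn_Icc_iff_integrableOn_Ioc).2 h1)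

lemma sol_props {m c : ℝ} (hm : 0 < m) {h z : ℝ → ℝ} (hh : IntegrableOn h (Ioc 0 1))
    (hz : ∀ t ∈ Icc (0:ℝ) 1, z t = c * t ^ m - tailInt m h t) :
    IntegrableOn (fun t => z t / t) (Ioc 0 1) ∧
    ∀ t ∈ Icc (0:ℝ) 1, z t = ∫ s in Ioc 0 t, (m / s * z s + h s) := by
  have hpow : ∀ t, 0 ≤ t → IntegrableOn (fun s : ℝ => s ^ (m - 1)) (Ioc 0 t) := by
    intro t ht
    rw [← intervalIntegrable_iff_integrableOn_Ioc_of_le ht]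
    exact intervalIntegral.intervalIntegrable_rpow' (by linarith)
  have e : EqOn (fun t => c * t ^ (m - 1) - tailInt m h t / t) (fun t => z t / t) (Ioc 0 1) := by
    intro t ht
    simp only
    rw [hz t ⟨ht.1.le, ht.2⟩, Real.rpow_sub_one ht.1.ne']
    ring
  have hti := tailInt_div_integrable hm hh
  refine ⟨IntegrableOn.congr_fun (((hpow 1 zero_le_one).const_mul c).sub hti) e
    measurableSet_Ioc, fun t ht => ?_⟩
  have s : Ioc 0 t ⊆ Ioc (0:ℝ) 1 := Ioc_subset_Ioc_right ht.2
  obtain ⟨g1, g2⟩ := tailInt_eq_prim hm hh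
  have e2 : EqOn (fun s => m / s * z s + h s)
      (fun s => (c * m) * s ^ (m - 1) - (m * (tailInt m h s / s) - h s)) (Ioc 0 t) := by
    intro u hu
    have := e (s hu)
    simp only at this ⊢
    have h3 : m / u * z u = m * (z u / u) := by ring
    rw [h3, ← this]; ring
  rw [setIntegral_congr_fun measurableSet_Ioc e2,
    integral_sub ((hpow t ht.1).const_mul _) (g1.mono_set s), ← g2 t ht, integral_const_mul,
    ← intervalIntegral.integral_of_le ht.1, integral_rpow (Or.inl (by linarith)), hz t ht]
  simp only [sub_add_cancel, Real.zero_rpow hm.ne']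
  field_simp
  ring

lemma compact_modulus (Φ : C(Icc (0:ℝ) 1, ℝ)) (C : ℝ) :
    IsCompact {u : C(Icc (0:ℝ) 1, ℝ) | (∀ t, |u t| ≤ C) ∧ ∀ s t, |u t - u s| ≤ |Φ t - Φ s|} := by
  apply ArzelaAscoli.isCompact_of_equicontinuous
  · have himg : (ContinuousMap.toFun '' {u : C(Icc (0:ℝ) 1, ℝ) |
        (∀ t, |u t| ≤ C) ∧ ∀ s t, |u t - u s| ≤ |Φ t - Φ s|}) =
        {u : Icc (0:ℝ) 1 → ℝ | (∀ t, |u t| ≤ C) ∧ ∀ s t, |u t - u s| ≤ |Φ t - Φ s|} := by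
      ext u
      constructor
      · rintro ⟨v, hv, rfl⟩; exact hv
      · intro hu
        refine ⟨⟨u, ?_⟩, hu, rfl⟩
        rw [Metric.continuous_iff']
        intro a ε hε
        filter_upwards [(Metric.continuous_iff'.1 Φ.continuous) a ε hε] with b hb
        exact lt_of_le_of_lt (hu.2 a b) hb
    rw [himg]
    have hK : IsCompact (Set.pi univ fun _ : Icc (0:ℝ) 1 => Icc (-C) C) :=
      isCompact_univ_pi fun _ => isCompact_Icc
    refine hK.of_isClosed_subset ?_ ?_
    · have : {u : Icc (0:ℝ) 1 → ℝ | (∀ t, |u t| ≤ C) ∧ ∀ s t, |u t - u s| ≤ |Φ t - Φ s|} =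
          (⋂ t, {u | |u t| ≤ C}) ∩ ⋂ s, ⋂ t, {u | |u t - u s| ≤ |Φ t - Φ s|} := by
        ext u; simp only [mem_ofPred_eq, mem_inter_iff, mem_iInter]
      rw [this]
      refine (isClosed_iInter fun t => isClosed_le (by fun_prop) (by fun_prop)).inter
        (isClosed_iInter fun s => isClosed_iInter fun t => isClosed_le (by fun_prop) (by fun_prop))
    · intro u hu t _
      exact abs_le.1 (hu.1 t)
  · intro a
    rw [Metric.equicontinuousAt_iff_right]
    intro ε hε
    filter_upwards [(Metric.continuous_iff'.1 Φ.continuous) a ε hε] with b hb u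
    rw [dist_comm]
    exact lt_of_le_of_lt (u.2.2 a b) hb

lemma exists_compact_op {m : ℝ} (hm : 0 < m) (T : C(Icc (0:ℝ) 1, ℝ) → ℝ → ℝ)
    (hT : IsLinearMap ℝ T) (hTint : ∀ u, IntegrableOn (T u) (Ioc 0 1))
    {w : ℝ → ℝ} (hw : IntegrableOn w (Ioc 0 1))
    (hTw : ∀ u, ∀ᵐ t ∂(volume.restrict (Ioc (0:ℝ) 1)), |T u t| ≤ ‖u‖ * w t)
    (hw0 : ∀ᵐ t ∂(volume.restrict (Ioc (0:ℝ) 1)), 0 ≤ w t) :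
    ∃ L : C(Icc (0:ℝ) 1, ℝ) →L[ℝ] C(Icc (0:ℝ) 1, ℝ), IsCompactOperator L ∧
      ∀ u (t : Icc (0:ℝ) 1), L u t = - tailInt m (T u) t := by
  have hcont : ∀ h : ℝ → ℝ, IntegrableOn h (Ioc 0 1) →
      Continuous fun t : Icc (0:ℝ) 1 => -tailInt m h t := fun h hh =>
    (continuousOn_iff_continuous_domRestrict.1 (tailInt_continuousOn hm hh)).neg
  let L0 : C(Icc (0:ℝ) 1, ℝ) →ₗ[ℝ] C(Icc (0:ℝ) 1, ℝ) :=
    { toFun := fun u => ⟨fun t => -tailInt m (T u) t, hcont _ (hTint u)⟩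
      map_add' := by
        intro u v
        ext t
        simp only [ContinuousMap.coe_mk, ContinuousMap.add_apply]
        rw [hT.map_add]
        have := tailInt_add hm t.2.1 (hTint u) (hTint v)
        change -tailInt m (fun r => T u r + T v r) t = _
        rw [this]; ring
      map_smul' := by
        intro c u
        ext t
        simp only [ContinuousMap.coe_mk, ContinuousMap.smul_apply, RingHom.id_apply, smul_eq_mul]
        rw [hT.map_smul]
        change -tailInt m (fun r => c * T u r) t = _
        rw [tailInt_smul]; ring }
  have L0a : ∀ u (t : Icc (0:ℝ) 1), L0 u t = - tailInt m (T u) t := fun _ _ => rfl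
  -- pointwise bound
  have hdom : ∀ u, ∀ t ∈ Icc (0:ℝ) 1, |tailInt m (T u) t| ≤ ‖u‖ * tailInt m w t := by
    intro u t ht
    rw [abs_le', ← tailInt_smul, ← tailInt_neg]
    constructor
    · refine tailInt_mono hm ht.1 (hTint u) (hw.const_mul _) ?_
      filter_upwards [hTw u] with r hr using (le_abs_self _).trans hr
    · refine tailInt_mono hm ht.1 (hTint u).neg (hw.const_mul _) ?_
      filter_upwards [hTw u] with r hr using (neg_le_abs _).trans hr
  obtain ⟨C, hC⟩ := isCompact_Icc.exists_bound_of_continuousOn (tailInt_continuousOn hm hw)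
  have hC0 : 0 ≤ C := (norm_nonneg _).trans (hC 0 ⟨le_rfl, zero_le_one⟩)
  have hbd : ∀ u (t : Icc (0:ℝ) 1), |L0 u t| ≤ C * ‖u‖ := by
    intro u t
    rw [L0a, abs_neg]
    refine (hdom u t t.2).trans ?_
    rw [mul_comm]
    exact mul_le_mul_of_nonneg_right ((le_abs_self _).trans (hC t t.2)) (norm_nonneg _)
  let L := L0.mkContinuous C (fun u => (ContinuousMap.norm_le _ (by positivity)).2 (hbd u))
  refine ⟨L, ?_, L0a⟩
  have hGi : IntegrableOn (fun s => m * (tailInt m w s / s) + w s) (Ioc 0 1) :=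
    ((tailInt_div_integrable hm hw).const_mul m).add hw
  let Φ : C(Icc (0:ℝ) 1, ℝ) := ⟨fun t => ∫ s in Ioc 0 (t:ℝ), (m * (tailInt m w s / s) + w s),
    continuousOn_iff_continuous_domRestrict.1 (intervalIntegral.continuousOn_primitive
      ((integrableOn_Icc_iff_integrableOn_Ioc).2 hGi))⟩
  have hsub : ∀ g : ℝ → ℝ, IntegrableOn g (Ioc 0 1) → ∀ s t : Icc (0:ℝ) 1, s ≤ t →
      (∫ r in Ioc 0 (t:ℝ), g r) - (∫ r in Ioc 0 (s:ℝ), g r) = ∫ r in Ioc (s:ℝ) t, g r := by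
    intro g hg s t hst
    have hst' : (s:ℝ) ≤ t := hst
    rw [← Ioc_union_Ioc_eq_Ioc s.2.1 hst', setIntegral_union (Ioc_disjoint_Ioc_of_le le_rfl)
      measurableSet_Ioc (hg.mono_set (Ioc_subset_Ioc_right s.2.2))
      (hg.mono_set (Ioc_subset_Ioc s.2.1 t.2.2))]
    ring
  have hmod : ∀ u, ‖u‖ ≤ 1 → ∀ s t : Icc (0:ℝ) 1, s ≤ t → |L0 u t - L0 u s| ≤ |Φ t - Φ s| := by
    intro u hu s t hst
    obtain ⟨g1, g2⟩ := tailInt_eq_prim hm (hTint u)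
    rw [L0a, L0a, g2 t t.2, g2 s s.2]
    have hΦ : Φ t - Φ s = ∫ r in Ioc (s:ℝ) t, (m * (tailInt m w r / r) + w r) := hsub _ hGi s t hst
    have h3 := hsub _ g1 s t hst
    have hss : Ioc (s:ℝ) t ⊆ Ioc 0 1 := Ioc_subset_Ioc s.2.1 t.2.2
    rw [hΦ, ← neg_sub', abs_neg, h3]
    refine le_trans ?_ (le_abs_self _)
    refine (norm_integral_le_integral_norm _).trans (integral_mono_ae (g1.mono_set hss).norm
      (hGi.mono_set hss) ?_)
    filter_upwards [ae_restrict_mem measurableSet_Ioc,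
      ae_restrict_of_ae_restrict_of_subset hss (hTw u),
      ae_restrict_of_ae_restrict_of_subset hss hw0] with r hr h1 h2
    have hr' := hss hr
    have d := hdom u r ⟨hr'.1.le, hr'.2⟩
    have hwn : 0 ≤ tailInt m w r := by
      have := tailInt_mono (h := fun _ => 0) hm hr'.1.le (integrableOn_zero) hw hw0
      simpa [tailInt] using this
    have d' : |tailInt m (T u) r| ≤ tailInt m w r :=
      d.trans (mul_le_of_le_one_left hwn hu)
    have h1' : |T u r| ≤ w r := h1.trans (mul_le_of_le_one_left h2 hu)
    rw [Real.norm_eq_abs]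
    refine (abs_sub _ _).trans (add_le_add ?_ h1')
    rw [abs_mul, abs_of_pos hm, abs_div, abs_of_pos hr'.1]
    exact mul_le_mul_of_nonneg_left (div_le_div_of_nonneg_right d' hr'.1.le) hm.le
  refine ⟨_, compact_modulus Φ C, ?_⟩
  filter_upwards [Metric.closedBall_mem_nhds (0 : C(Icc (0:ℝ) 1, ℝ)) one_pos] with u hu
  have hu' : ‖u‖ ≤ 1 := by simpa using hu
  refine ⟨fun t => (hbd u t).trans (mul_le_of_le_one_right hC0 hu'), fun s t => ?_⟩
  rcases le_total s t with h | h
  · exact hmod u hu' s t h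
  · rw [abs_sub_comm, abs_sub_comm (Φ t)]
    exact hmod u hu' t s h

lemma pos_bounds (T : C(Icc (0:ℝ) 1, ℝ) → ℝ → ℝ) (hT : IsLinearMap ℝ T)
    (hpos : ∀ u : C(Icc (0:ℝ) 1, ℝ), (∀ t, 0 ≤ u t) →
      ∀ᵐ t ∂(volume.restrict (Ioc (0:ℝ) 1)), 0 ≤ T u t)
    (u : C(Icc (0:ℝ) 1, ℝ)) (M N : ℝ) (hM : ∀ t, u t ≤ M) (hN : ∀ t, -N ≤ u t) :
    ∀ᵐ t ∂(volume.restrict (Ioc (0:ℝ) 1)), T u t ≤ M * T 1 t ∧ -T u t ≤ N * T 1 t := by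
  have h1 := hpos (M • (1 : C(Icc (0:ℝ) 1, ℝ)) - u) (by intro t; simpa using hM t)
  have h2 := hpos (N • (1 : C(Icc (0:ℝ) 1, ℝ)) + u)
    (by intro t; have := hN t; simp; linarith)
  rw [hT.map_sub, hT.map_smul] at h1
  rw [hT.map_add, hT.map_smul] at h2
  filter_upwards [h1, h2] with t a b
  simp only [Pi.sub_apply, Pi.add_apply, Pi.smul_apply, smul_eq_mul] at a b
  constructor <;> linarith

theorem stmt_15 (𝒯p 𝒯m : ℝ) (h𝒯p0 : 0 ≤ 𝒯p) (h𝒯m0 : 0 ≤ 𝒯m)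
    (h1 : 𝒯m ≤ 1) (h2 : 𝒯p ≤ 2 * Real.sqrt (1 - 𝒯m))
    (k : ℝ) (hk : k < 0)
    (Tp Tm : C(Icc (0:ℝ) 1, ℝ) → ℝ → ℝ)
    (hTplin : IsLinearMap ℝ Tp) (hTmlin : IsLinearMap ℝ Tm)
    (hTpint : ∀ u, IntegrableOn (Tp u) (Ioc 0 1))
    (hTmint : ∀ u, IntegrableOn (Tm u) (Ioc 0 1))
    (hTppos : ∀ u : C(Icc (0:ℝ) 1, ℝ), (∀ t, 0 ≤ u t) →
      ∀ᵐ t ∂(volume.restrict (Ioc (0:ℝ) 1)), 0 ≤ Tp u t)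
    (hTmpos : ∀ u : C(Icc (0:ℝ) 1, ℝ), (∀ t, 0 ≤ u t) →
      ∀ᵐ t ∂(volume.restrict (Ioc (0:ℝ) 1)), 0 ≤ Tm u t)
    (hTpnorm : (∫ t in Ioc (0:ℝ) 1, Tp 1 t) = 𝒯p)
    (hTmnorm : (∫ t in Ioc (0:ℝ) 1, Tm 1 t) = 𝒯m)
    (f : ℝ → ℝ) (hf : IntegrableOn f (Ioc 0 1)) (c : ℝ) :
    ∃! x : C(Icc (0:ℝ) 1, ℝ),
      (Set.IccExtend (by norm_num : (0:ℝ) ≤ 1) x) 0 = 0 ∧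
      (Set.IccExtend (by norm_num : (0:ℝ) ≤ 1) x) 1 = c ∧
      IntegrableOn
        (fun t => |Set.IccExtend (by norm_num : (0:ℝ) ≤ 1) x t| / t) (Ioc 0 1) ∧
      ∃ g : ℝ → ℝ, IntegrableOn g (Ioc 0 1) ∧
        (∀ t ∈ Icc (0:ℝ) 1,
          Set.IccExtend (by norm_num : (0:ℝ) ≤ 1) x t = ∫ s in Ioc (0:ℝ) t, g s) ∧
        (∀ᵐ t ∂(volume.restrict (Ioc (0:ℝ) 1)),
          g t = -(k / t) * Set.IccExtend (by norm_num : (0:ℝ) ≤ 1) x t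
            + (Tp x t - Tm x t) + f t) := by
  have h01 : (0:ℝ) ≤ 1 := zero_le_one
  obtain ⟨m, hm, rfl⟩ : ∃ m : ℝ, 0 < m ∧ k = -m := ⟨-k, by linarith, by ring⟩
  let T : C(Icc (0:ℝ) 1, ℝ) → ℝ → ℝ := fun u => Tp u - Tm u
  have hT : IsLinearMap ℝ T :=
    ⟨fun u v => by simp only [T, hTplin.map_add, hTmlin.map_add]; abel,
     fun a u => by simp only [T, hTplin.map_smul, hTmlin.map_smul, smul_sub]⟩
  have hTint : ∀ u, IntegrableOn (T u) (Ioc 0 1) := fun u => (hTpint u).sub (hTmint u)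
  have hp0 := hTppos 1 (fun t => by simp)
  have hq0 := hTmpos 1 (fun t => by simp)
  obtain ⟨L, hL, hLa⟩ := exists_compact_op (w := fun t => Tp 1 t + Tm 1 t) hm T hT hTint
    ((hTpint 1).add (hTmint 1))
    (by
      intro u
      have hb : ∀ t, |u t| ≤ ‖u‖ := fun t => u.norm_coe_le_norm t
      filter_upwards [pos_bounds Tp hTplin hTppos u ‖u‖ ‖u‖ (fun t => (abs_le.1 (hb t)).2)
          (fun t => (abs_le.1 (hb t)).1), pos_bounds Tm hTmlin hTmpos u ‖u‖ ‖u‖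
          (fun t => (abs_le.1 (hb t)).2) (fun t => (abs_le.1 (hb t)).1)] with t a b
      simp only [T, Pi.sub_apply]
      rw [abs_le']
      constructor <;> linarith [a.1, a.2, b.1, b.2])
    (by filter_upwards [hp0, hq0] with t a b using add_nonneg a b)
  -- homogeneous uniqueness
  have hhom : ∀ x, L x = x → x = 0 := by
    intro x hx
    have hxa : ∀ t : Icc (0:ℝ) 1, tailInt m (T x) t = - x t := by
      intro t
      have := hLa x t
      rw [hx] at this
      linarith
    obtain ⟨t1, -, ht1⟩ := isCompact_univ.exists_isMaxOn (univ_nonempty) x.continuous.continuousOn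
    obtain ⟨t2, -, ht2⟩ := isCompact_univ.exists_isMinOn (univ_nonempty) x.continuous.continuousOn
    have hmax : ∀ t, x t ≤ x t1 := fun t => ht1 (mem_univ t)
    have hmin : ∀ t, x t2 ≤ x t := fun t => ht2 (mem_univ t)
    have hone : x ⟨1, h01, le_rfl⟩ = 0 := by
      have := hxa ⟨1, h01, le_rfl⟩
      simp only [tailInt_one] at this
      linarith
    have hM : 0 ≤ x t1 := by have := hmax ⟨1, h01, le_rfl⟩; linarith
    have hN : 0 ≤ -x t2 := by have := hmin ⟨1, h01, le_rfl⟩; linarith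
    have bp := pos_bounds Tp hTplin hTppos x (x t1) (-x t2) hmax (by simpa using hmin)
    have bm := pos_bounds Tm hTmlin hTmpos x (x t1) (-x t2) hmax (by simpa using hmin)
    have hup : ∀ᵐ t ∂(volume.restrict (Ioc (0:ℝ) 1)),
        T x t ≤ x t1 * Tp 1 t + (-x t2) * Tm 1 t := by
      filter_upwards [bp, bm] with t a b
      simp only [T, Pi.sub_apply]; linarith [a.1, b.2]
    have hlo : ∀ᵐ t ∂(volume.restrict (Ioc (0:ℝ) 1)),
        -T x t ≤ (-x t2) * Tp 1 t + x t1 * Tm 1 t := by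
      filter_upwards [bp, bm] with t a b
      simp only [T, Pi.sub_apply]; linarith [a.2, b.1]
    have := key hm h1 h2 (hTpint 1) (hTmint 1) (hTint x) hp0 hq0 hTpnorm hTmnorm hM hN
      (fun h0 => by rw [h0] at hlo; simpa using hlo)
      (fun h0 => by rw [h0] at hup; simpa using hup) hup hlo t1.2 t2.2 (hxa t1) (hxa t2)
    ext t
    have a := hmax t
    have b := hmin t
    simp only [ContinuousMap.zero_apply]
    linarith [this.1, this.2]
  -- solvability of the integral equation
  let b : C(Icc (0:ℝ) 1, ℝ) := ⟨fun t => c * (t:ℝ) ^ m - tailInt m f t, by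
    refine Continuous.sub (continuous_const.mul
      (continuous_subtype_val.rpow_const fun _ => Or.inr hm.le)) ?_
    exact continuousOn_iff_continuous_domRestrict.1 (tailInt_continuousOn hm hf)⟩
  have hsurj : ∃ x, x - L x = b := by
    rcases hL.hasEigenvalue_or_mem_resolventSet (one_ne_zero (α := ℝ)) with h | h
    · exfalso
      obtain ⟨v, hv⟩ := h.exists_hasEigenvector
      have := hv.apply_eq_smul
      rw [one_smul] at this
      exact hv.2 (hhom v this)
    · rw [spectrum.mem_resolventSet_iff, map_one] at h
      obtain ⟨U, hU⟩ := h
      refine ⟨(↑U⁻¹ : C(Icc (0:ℝ) 1, ℝ) →L[ℝ] C(Icc (0:ℝ) 1, ℝ)) b, ?_⟩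
      have h3 := U.mul_inv
      rw [hU] at h3
      have h4 := congrArg (fun A : C(Icc (0:ℝ) 1, ℝ) →L[ℝ] C(Icc (0:ℝ) 1, ℝ) => A b) h3
      simpa using h4
  have hHint : ∀ x, IntegrableOn (fun t => T x t + f t) (Ioc 0 1) := fun x => (hTint x).add hf
  have hadd : ∀ x (t : Icc (0:ℝ) 1), tailInt m (fun t => T x t + f t) t =
      tailInt m (T x) t + tailInt m f t := fun x t => tailInt_add hm t.2.1 (hTint x) hf
  -- every solution satisfies the integral equation
  have hnec : ∀ x : C(Icc (0:ℝ) 1, ℝ), ((Set.IccExtend h01 x) 1 = c ∧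
      IntegrableOn (fun t => |Set.IccExtend h01 x t| / t) (Ioc 0 1) ∧
      ∃ g : ℝ → ℝ, IntegrableOn g (Ioc 0 1) ∧
        (∀ t ∈ Icc (0:ℝ) 1, Set.IccExtend h01 x t = ∫ s in Ioc (0:ℝ) t, g s) ∧
        (∀ᵐ t ∂(volume.restrict (Ioc (0:ℝ) 1)),
          g t = -(-m / t) * Set.IccExtend h01 x t + (Tp x t - Tm x t) + f t)) → x - L x = b := by
    rintro x ⟨hx1, hxi, g, hgi, hxg, hg⟩
    let y : C(Icc (0:ℝ) 1, ℝ) := L x + b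
    have hy : ∀ t ∈ Icc (0:ℝ) 1, IccExtend h01 y t =
        c * t ^ m - tailInt m (fun t => T x t + f t) t := by
      intro t ht
      rw [IccExtend_of_mem h01 _ ht, hadd x ⟨t, ht⟩]
      simp only [y, ContinuousMap.add_apply, hLa, b, ContinuousMap.coe_mk]
      ring
    obtain ⟨y1, y2⟩ := sol_props hm (hHint x) hy
    let w : ℝ → ℝ := fun t => IccExtend h01 x t - IccExtend h01 y t
    have hwc : Continuous w := (x.continuous.Icc_extend').sub (y.continuous.Icc_extend')
    have hyi : IntegrableOn (fun s => m / s * IccExtend h01 y s + (T x s + f s)) (Ioc 0 1) := by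
      refine IntegrableOn.congr_fun ((y1.const_mul m).add (hHint x)) ?_ measurableSet_Ioc
      intro s hs
      simp only [Pi.add_apply]
      ring
    have hae : ∀ᵐ s ∂(volume.restrict (Ioc (0:ℝ) 1)),
        g s - (m / s * IccExtend h01 y s + (T x s + f s)) = m / s * w s := by
      filter_upwards [hg] with s hs
      rw [hs]
      simp only [T, w, Pi.sub_apply]
      ring
    have hz := ode_unique (m := m) hwc ((hgi.sub hyi).congr hae) (by
      intro t ht
      have hs : Ioc 0 t ⊆ Ioc (0:ℝ) 1 := Ioc_subset_Ioc_right ht.2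
      rw [← integral_congr_ae (ae_restrict_of_ae_restrict_of_subset hs hae),
        integral_sub (hgi.mono_set hs) (hyi.mono_set hs), ← hxg t ht, ← y2 t ht]) (by
      simp only [w]
      rw [hx1, hy 1 ⟨h01, le_rfl⟩, tailInt_one]
      simp)
    have hxy : x = y := by
      ext t
      have := hz t t.2
      simp only [w, IccExtend_val] at this
      linarith
    rw [sub_eq_iff_eq_add, add_comm]
    exact hxy
  obtain ⟨x, hx⟩ := hsurj
  refine ⟨x, ?_, ?_⟩
  · have hxe : ∀ t ∈ Icc (0:ℝ) 1, IccExtend h01 x t =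
        c * t ^ m - tailInt m (fun t => T x t + f t) t := by
      intro t ht
      rw [IccExtend_of_mem h01 _ ht, hadd x ⟨t, ht⟩]
      have h3 := congrArg (fun u : C(Icc (0:ℝ) 1, ℝ) => u ⟨t, ht⟩) hx
      simp only [ContinuousMap.sub_apply, hLa, b, ContinuousMap.coe_mk] at h3
      linarith
    obtain ⟨y1, y2⟩ := sol_props hm (hHint x) hxe
    refine ⟨?_, ?_, ?_, fun s => m / s * IccExtend h01 x s + (T x s + f s), ?_, y2, ?_⟩
    · rw [hxe 0 ⟨le_rfl, h01⟩, tailInt_zero hm, Real.zero_rpow hm.ne']; simp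
    · rw [hxe 1 ⟨h01, le_rfl⟩, tailInt_one]; simp
    · refine IntegrableOn.congr_fun y1.abs ?_ measurableSet_Ioc
      intro s hs
      simp only [abs_div, abs_of_pos hs.1]
    · refine IntegrableOn.congr_fun ((y1.const_mul m).add (hHint x)) ?_ measurableSet_Ioc
      intro s hs
      simp only [Pi.add_apply]
      ring
    · refine Eventually.of_forall fun s => ?_
      simp only [T, Pi.sub_apply]
      ring
  · intro x' hx'
    have h3 := hnec x' hx'.2
    have h4 : x' - x = 0 := by
      apply hhom
      rw [map_sub]
      have := h3.trans hx.symm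
      rw [sub_eq_sub_iff_sub_eq_sub] at this
      exact this.symm
    exact sub_eq_zero.1 h4
end
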